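/- arXiv:1801.09537 — 3 statements merged into one kernel-verified Lean document; each statement's English description precedes it below -/
import Mathlib

section
/- Let f : ℝ → ℂ be a positive definite function that is real-analytic on some open neighborhood of the origin. Then f is real-analytic on all of ℝ, and there exist α, β ∈ (0, +∞] and a finite nonnegative Borel measure μ on ℝ such that for every z ∈ ℂ with −α < Im z < β the integral ∫ℝ e^{izt} dμ(t) converges, the function f̃(z) = ∫ℝ e^{izt} dμ(t) is holomorphic on the horizontal strip S_{−α,β}, and f̃(x) = f(x) for every x ∈ ℝ; moreover α and β can be taken maximal: if α < ∞ then f̃ admits no holomorphic extension to any open neighborhood of −iα, and if β < ∞ then f̃ admits no holomorphic extension to any open neighborhood of iβ. -/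
open Complex MeasureTheory Filter Set Topology
open scoped Real BigOperators ComplexOrder

noncomputable section

/-- `f : ℝ → ℂ` is positive definite. -/
def IsPosDefFun (f : ℝ → ℂ) : Prop :=
  ∀ (n : ℕ) (x : Fin n → ℝ) (ξ : Fin n → ℂ),
    0 ≤ ∑ k, ∑ l, f (x k - x l) * ξ k * (starRingEnd ℂ) (ξ l)

/-- `f` is positive definite on `S ⊆ ℂ`. -/
def IsPosDefOnC (f : ℂ → ℂ) (S : Set ℂ) : Prop :=
  ∀ (n : ℕ) (z : Fin n → ℂ), (∀ k l, z k - (starRingEnd ℂ) (z l) ∈ S) →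
    ∀ ξ : Fin n → ℂ,
      0 ≤ ∑ k, ∑ l, f (z k - (starRingEnd ℂ) (z l)) * ξ k * (starRingEnd ℂ) (ξ l)

/-- `f` is co-positive definite on `T ⊆ ℂ`. -/
def IsCoPosDefOnC (f : ℂ → ℂ) (T : Set ℂ) : Prop :=
  ∀ (n : ℕ) (z : Fin n → ℂ), (∀ k l, z k + (starRingEnd ℂ) (z l) ∈ T) →
    ∀ ξ : Fin n → ℂ,
      0 ≤ ∑ k, ∑ l, f (z k + (starRingEnd ℂ) (z l)) * ξ k * (starRingEnd ℂ) (ξ l)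

/-- `G : ℝ → ℂ` is co-positive definite on `I ⊆ ℝ`. -/
def IsCoPosDefOnR (G : ℝ → ℂ) (I : Set ℝ) : Prop :=
  ∀ (n : ℕ) (x : Fin n → ℝ), (∀ k l, x k + x l ∈ I) →
    ∀ ξ : Fin n → ℂ,
      0 ≤ ∑ k, ∑ l, G (x k + x l) * ξ k * (starRingEnd ℂ) (ξ l)

/-- Horizontal strip `S_{a,b}`. -/
def HStrip (a b : EReal) : Set ℂ := {z | a < (z.im : EReal) ∧ (z.im : EReal) < b}

/-- Vertical strip `T_{a,b}`. -/
def VStrip (a b : EReal) : Set ℂ := {z | a < (z.re : EReal) ∧ (z.re : EReal) < b}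

/-- `μ` is exponentially finite with respect to the interval `(a,b)`. -/
def ExpFinite (μ : Measure ℝ) (a b : EReal) : Prop :=
  ∀ y : ℝ, a < (y : EReal) → (y : EReal) < b →
    Integrable (fun t : ℝ => Real.exp (-y * t)) μ

open ProbabilityTheory

lemma aux_memLp (ν : Measure ℝ) [IsFiniteMeasure ν] (n : ℕ)
    (h : Integrable (fun t : ℝ => t ^ (2 * n)) ν) : MemLp id ((2 * n : ℕ) : ENNReal) ν := by
  rcases Nat.eq_zero_or_pos n with rfl | hn
  · simpa using by fun_prop
  · rw [← integrable_norm_rpow_iff (by fun_prop) (by simp; omega) (ENNReal.natCast_ne_top _)]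
    refine h.congr (.of_forall fun t => ?_)
    simp only [ENNReal.toReal_natCast, Real.rpow_natCast, id, Real.norm_eq_abs, pow_mul, sq_abs]

lemma aux_second_diff (ψ : ℝ → ℂ) (h : AnalyticAt ℝ ψ 0) :
    ∃ C : ℝ, ∀ᶠ x : ℝ in 𝓝 0, ‖2 * ψ 0 - ψ x - ψ (-x)‖ ≤ C * x ^ 2 := by
  obtain ⟨p, hp⟩ := h
  have h1 := hp.isBigO_sub_partialSum_pow 2
  simp only [zero_add] at h1
  have hneg : Tendsto (fun x : ℝ => -x) (𝓝 0) (𝓝 0) := by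
    simpa using (continuous_neg (G := ℝ)).tendsto 0
  have h2 := h1.comp_tendsto hneg
  have h3 := (h1.add (by simpa [Function.comp_def] using h2))
  obtain ⟨C, hC⟩ := h3.bound
  refine ⟨C, hC.mono fun x hx => ?_⟩
  have h0 : ψ 0 = p.coeff 0 := by
    rw [← hp.coeff_zero (fun _ => 1)]; simp
  simp only [FormalMultilinearSeries.partialSum, Finset.sum_range_succ, Finset.sum_range_zero,
    FormalMultilinearSeries.apply_eq_pow_smul_coeff] at hx
  have e : 2 * ψ 0 - ψ x - ψ (-x) = -(ψ x - (0 + x ^ 0 • p.coeff 0 + x ^ 1 • p.coeff 1) +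
      (ψ (-x) - (0 + (-x) ^ 0 • p.coeff 0 + (-x) ^ 1 • p.coeff 1))) := by
    rw [h0]; simp; ring
  rw [e, norm_neg]
  simpa using hx

lemma aux_moment_step (ν : Measure ℝ) [IsFiniteMeasure ν] (hA : AnalyticAt ℝ (charFun ν) 0)
    (n : ℕ) (hn : Integrable (fun t : ℝ => t ^ (2 * n)) ν) :
    Integrable (fun t : ℝ => t ^ (2 * (n + 1))) ν := by
  have hψ : AnalyticAt ℝ (iteratedDeriv (2 * n) (charFun ν)) 0 := by
    rw [iteratedDeriv_eq_iterate]; exact hA.iterated_deriv _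
  obtain ⟨C, hC⟩ := aux_second_diff _ hψ
  have hform : ∀ x : ℝ, iteratedDeriv (2 * n) (charFun ν) x
      = (-1) ^ n * ∫ t : ℝ, ((t ^ (2 * n) : ℝ) : ℂ) * cexp (x * t * I) ∂ν := by
    intro x
    rw [iteratedDeriv_charFun (aux_memLp ν n hn), pow_mul, I_sq]
    push_cast
    rfl
  have hintg : ∀ x : ℝ, Integrable (fun t : ℝ => ((t ^ (2 * n) : ℝ) : ℂ) * cexp (x * t * I)) ν := by
    intro x
    refine hn.ofReal.mul_bdd (c := 1) (by fun_prop) (.of_forall fun t => ?_)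
    rw [← ofReal_mul, norm_exp_ofReal_mul_I]
  have hD : ∀ x : ℝ, ∫ t : ℝ, t ^ (2 * n) * (2 - 2 * Real.cos (x * t)) ∂ν
      ≤ ‖2 * iteratedDeriv (2 * n) (charFun ν) 0 - iteratedDeriv (2 * n) (charFun ν) x
        - iteratedDeriv (2 * n) (charFun ν) (-x)‖ := by
    intro x
    have e : (2 * iteratedDeriv (2 * n) (charFun ν) 0 - iteratedDeriv (2 * n) (charFun ν) x
        - iteratedDeriv (2 * n) (charFun ν) (-x))
        = (-1) ^ n * ((∫ t : ℝ, t ^ (2 * n) * (2 - 2 * Real.cos (x * t)) ∂ν : ℝ) : ℂ) := by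
      rw [hform, hform, hform, ← integral_complex_ofReal]
      have : ∀ a b c : ℂ, 2 * ((-1) ^ n * a) - (-1) ^ n * b - (-1) ^ n * c
        = (-1) ^ n * (2 * a - b - c) := by intros; ring
      rw [this, ← integral_const_mul, ← integral_sub ((hintg 0).const_mul 2) (hintg x),
        ← integral_sub (by exact ((hintg 0).const_mul 2).sub (hintg x)) (hintg (-x))]
      congr 2
      ext t
      have hc : 2 * Complex.cos (x * t) = cexp (x * t * I) + cexp (-(x * t) * I) := by
        rw [Complex.two_cos]
      push_cast
      rw [hc]
      simp
      ring
    rw [e]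
    simp only [norm_mul, norm_pow, norm_neg, norm_one, one_pow, one_mul, norm_real]
    exact le_abs_self _
  have hpos : ∀ x t : ℝ, 0 ≤ t ^ (2 * n) * (2 - 2 * Real.cos (x * t)) := by
    intro x t
    have := Real.cos_le_one (x * t)
    have h2 : 0 ≤ t ^ (2 * n) := by rw [pow_mul]; positivity
    exact mul_nonneg h2 (by linarith)
  let u : ℕ → ℝ := fun k => 1 / ((k : ℝ) + 1)
  have hu : Tendsto u atTop (𝓝 0) := tendsto_one_div_add_atTop_nhds_zero_nat
  have hupos : ∀ k, 0 < u k := fun k => by positivity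
  have hu' : Tendsto u atTop (𝓝[≠] 0) :=
    tendsto_nhdsWithin_iff.2 ⟨hu, .of_forall fun k => (hupos k).ne'⟩
  let G : ℕ → ℝ → ℝ := fun k t => t ^ (2 * n) * (2 - 2 * Real.cos (u k * t)) / (u k) ^ 2
  have hGlim : ∀ t : ℝ, Tendsto (fun k => G k t) atTop (𝓝 (t ^ (2 * (n + 1)))) := by
    intro t
    have hs : Tendsto (fun k => (Real.sinc (u k * t / 2)) ^ 2 * t ^ (2 * n) * t ^ 2) atTop
        (𝓝 (Real.sinc (0 * t / 2) ^ 2 * t ^ (2 * n) * t ^ 2)) := by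
      have := (Real.continuous_sinc.tendsto (0 * t / 2)).comp ((hu.mul_const t).div_const 2)
      exact ((this.pow 2).mul_const _).mul_const _
    have e : (Real.sinc (0 * t / 2) ^ 2 * t ^ (2 * n) * t ^ 2) = t ^ (2 * (n + 1)) := by
      simp; ring
    rw [e] at hs
    refine hs.congr fun k => ?_
    by_cases ht : t = 0
    · subst ht; simp [G]
    have hk := (hupos k).ne'
    rw [Real.sinc_of_ne_zero (by simp [ht, hk])]
    simp only [G]
    have : Real.cos (u k * t) = 1 - 2 * Real.sin (u k * t / 2) ^ 2 := by
      have := Real.cos_two_mul (u k * t / 2)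
      have h3 := Real.sin_sq_add_cos_sq (u k * t / 2)
      rw [show 2 * (u k * t / 2) = u k * t by ring] at this
      linarith
    rw [this]
    field_simp
    ring
  have hGint : ∀ k, Integrable (G k) ν := by
    intro k
    refine Integrable.div_const ?_ _
    refine hn.mul_bdd (c := 4) (by fun_prop) (.of_forall fun t => ?_)
    have h1 := Real.cos_le_one (u k * t)
    have h2 := Real.neg_one_le_cos (u k * t)
    rw [Real.norm_eq_abs, abs_le]; constructor <;> linarith
  have hGb : ∀ᶠ k in atTop, ∫⁻ t, ‖G k t‖ₑ ∂ν ≤ ENNReal.ofReal C := by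
    filter_upwards [hu.eventually hC] with k hk
    have hnn : ∀ t, 0 ≤ G k t := fun t => div_nonneg (hpos _ _) (by positivity)
    have : ∫⁻ t, ‖G k t‖ₑ ∂ν = ENNReal.ofReal (∫ t, G k t ∂ν) := by
      rw [ofReal_integral_eq_lintegral_ofReal (hGint k) (.of_forall hnn)]
      refine lintegral_congr fun t => ?_
      rw [Real.enorm_eq_ofReal (hnn t)]
    rw [this]
    apply ENNReal.ofReal_le_ofReal
    simp only [G]
    rw [integral_div, div_le_iff₀ (by have := hupos k; positivity)]
    exact (hD (u k)).trans hk
  refine integrable_of_tendsto (.of_forall hGlim) (fun k => (hGint k).aestronglyMeasurable) ?_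
  refine ne_top_of_le_ne_top (b := ENNReal.ofReal C) (by simp) ?_
  exact liminf_le_of_frequently_le' hGb.frequently

lemma aux_moments (ν : Measure ℝ) [IsFiniteMeasure ν] (hA : AnalyticAt ℝ (charFun ν) 0)
    (n : ℕ) : Integrable (fun t : ℝ => t ^ (2 * n)) ν := by
  induction n with
  | zero => simp
  | succ n ih => exact aux_moment_step ν hA n ih

lemma aux_realderiv (F : ℂ → ℂ) (R : ℝ) (hF : DifferentiableOn ℂ F (Metric.ball 0 R)) (n : ℕ) :
    ∀ x : ℝ, |x| < R → iteratedDeriv n (fun x : ℝ => F x) x = iteratedDeriv n F x := by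
  induction n with
  | zero => intro x _; simp
  | succ n ih =>
    intro x hx
    rw [iteratedDeriv_succ, iteratedDeriv_succ]
    have hev : iteratedDeriv n (fun x : ℝ => F x) =ᶠ[𝓝 x] fun y : ℝ => iteratedDeriv n F y := by
      have : ∀ᶠ y : ℝ in 𝓝 x, |y| < R := (continuous_abs.tendsto x).eventually_lt_const hx
      exact this.mono fun y hy => ih y hy
    rw [hev.deriv_eq]
    have han : AnalyticAt ℂ F (x : ℂ) :=
      hF.analyticAt (Metric.isOpen_ball.mem_nhds (by simpa using hx))
    have h2 : AnalyticAt ℂ (iteratedDeriv n F) (x : ℂ) := by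
      rw [iteratedDeriv_eq_iterate]; exact han.iterated_deriv n
    exact h2.differentiableAt.hasDerivAt.comp_ofReal.deriv

lemma aux_engine (ν : Measure ℝ) [IsFiniteMeasure ν] (F : ℂ → ℂ) (R : ℝ)
    (hF : DifferentiableOn ℂ F (Metric.ball 0 R))
    (heq : ∀ᶠ x : ℝ in 𝓝 0, charFun ν x = F x) (s : ℝ) (hs : |s| < R) :
    Integrable (fun t : ℝ => Real.exp (s * t)) ν := by
  obtain ⟨r, hsr, hrR⟩ := exists_between hs
  have hr : 0 < r := (abs_nonneg s).trans_lt hsr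
  have hR : 0 < R := hr.trans hrR
  have han : AnalyticAt ℂ F ((0 : ℝ) : ℂ) :=
    hF.analyticAt (Metric.isOpen_ball.mem_nhds (by simpa using hR))
  have hA : AnalyticAt ℝ (charFun ν) 0 := by
    have h1 : AnalyticAt ℝ (fun x : ℝ => F x) 0 :=
      AnalyticAt.fun_comp (g := F) (f := fun x : ℝ => (x : ℂ)) han.restrictScalars
        (ofRealCLM.analyticAt 0)
    exact h1.congr (heq.mono fun x hx => hx.symm)
  have hmom := aux_moments ν hA
  have hcl : Metric.closedBall (0 : ℂ) r ⊆ Metric.ball 0 R := Metric.closedBall_subset_ball hrR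
  obtain ⟨C, hC⟩ := (isCompact_closedBall (0 : ℂ) r).exists_bound_of_continuousOn
    (hF.continuousOn.mono hcl)
  have hbound : ∀ n : ℕ, ∫ t : ℝ, t ^ (2 * n) ∂ν ≤ (2 * n).factorial * C / r ^ (2 * n) := by
    intro n
    have h1 : iteratedDeriv (2 * n) (charFun ν) 0 = iteratedDeriv (2 * n) F ((0 : ℝ) : ℂ) := by
      rw [← aux_realderiv F R hF (2 * n) 0 (by simpa using hR)]
      exact Filter.EventuallyEq.iteratedDeriv_eq _ heq
    have h2 : ‖iteratedDeriv (2 * n) F 0‖ ≤ (2 * n).factorial * C / r ^ (2 * n) := by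
      apply norm_iteratedDeriv_le_of_forall_mem_sphere_norm_le _ hr
      · exact (hF.mono hcl).diffContOnCl_ball subset_rfl
      · intro z hz; exact hC z (Metric.sphere_subset_closedBall hz)
    rw [ofReal_zero] at h1
    rw [← h1, iteratedDeriv_charFun_zero (aux_memLp ν n (hmom n))] at h2
    refine le_trans ?_ h2
    simp only [norm_mul, norm_pow, norm_I, one_pow, one_mul, norm_real]
    exact le_abs_self _
  have hC0 : 0 ≤ C := (norm_nonneg _).trans (hC 0 (by simp [hr.le]))
  have hcosh : ∫⁻ t, ENNReal.ofReal (Real.cosh (s * t)) ∂ν < ⊤ := by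
    have h1 : ∀ t : ℝ, ENNReal.ofReal (Real.cosh (s * t))
        = ∑' n : ℕ, ENNReal.ofReal ((s * t) ^ (2 * n) / (2 * n).factorial) := by
      intro t
      rw [← (Real.hasSum_cosh (s * t)).tsum_eq, ENNReal.ofReal_tsum_of_nonneg]
      · intro n; rw [pow_mul]; positivity
      · exact (Real.hasSum_cosh (s * t)).summable
    simp_rw [h1]
    rw [lintegral_tsum (fun n => by fun_prop)]
    have h2 : ∀ n : ℕ, ∫⁻ t, ENNReal.ofReal ((s * t) ^ (2 * n) / (2 * n).factorial) ∂ν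
        ≤ ENNReal.ofReal (C * ((s / r) ^ 2) ^ n) := by
      intro n
      have h3 : ∀ t : ℝ, (s * t) ^ (2 * n) / (2 * n).factorial
          = (s ^ (2 * n) / (2 * n).factorial) * t ^ (2 * n) := by intro t; ring
      simp_rw [h3]
      rw [← ofReal_integral_eq_lintegral_ofReal ((hmom n).const_mul _)
        (.of_forall fun t => by simp only [pow_mul, Pi.zero_apply]; positivity), integral_const_mul]
      apply ENNReal.ofReal_le_ofReal
      have h4 : 0 ≤ s ^ (2 * n) / (2 * n).factorial := by rw [pow_mul]; positivity
      refine (mul_le_mul_of_nonneg_left (hbound n) h4).trans_eq ?_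
      have := Nat.factorial_ne_zero (2 * n)
      rw [← pow_mul, div_pow]
      field_simp
    refine (ENNReal.tsum_le_tsum h2).trans_lt ?_
    have hlt : (s / r) ^ 2 < 1 := by
      rw [sq_lt_one_iff_abs_lt_one, abs_div, abs_of_pos hr, div_lt_one hr]; exact hsr
    have hsum : Summable fun n : ℕ => C * ((s / r) ^ 2) ^ n :=
      (summable_geometric_of_lt_one (sq_nonneg _) hlt).mul_left C
    rw [← ENNReal.ofReal_tsum_of_nonneg (fun n => by positivity) hsum]
    exact ENNReal.ofReal_lt_top
  have hci : Integrable (fun t : ℝ => Real.cosh (s * t)) ν := by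
    refine ⟨by fun_prop, ?_⟩
    rw [hasFiniteIntegral_iff_ofReal (.of_forall fun t => (Real.cosh_pos _).le)]
    exact hcosh
  refine (hci.const_mul 2).mono' (by fun_prop) (.of_forall fun t => ?_)
  rw [Real.norm_eq_abs, Real.abs_exp, Real.cosh_eq]
  have := Real.exp_pos (-(s * t))
  linarith

/-- Landau-type lemma: holomorphic extension of the transform gives more integrability. -/
lemma aux_landau (μ : Measure ℝ) (s₀ : ℝ)
    (hs₀ : s₀ ∈ interior (integrableExpSet id μ)) (G : ℂ → ℂ) (R : ℝ) (hR : 0 < R)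
    (hG : DifferentiableOn ℂ G (Metric.ball (s₀ : ℂ) R))
    (heq : ∀ z ∈ Metric.ball (s₀ : ℂ) R, z.re ∈ interior (integrableExpSet id μ) →
      G z = complexMGF id μ z) (s : ℝ) (hs : |s| < R) :
    s₀ + s ∈ integrableExpSet id μ := by
  have hi : Integrable (fun t : ℝ => Real.exp (s₀ * t)) μ := by
    have hi2 : s₀ ∈ integrableExpSet id μ := interior_subset hs₀
    exact hi2
  let d : ℝ → ENNReal := fun t => ENNReal.ofReal (Real.exp (s₀ * t))
  have hd : Measurable d := by fun_prop
  have hdt : ∀ᵐ t ∂μ, d t < ⊤ := .of_forall fun t => ENNReal.ofReal_lt_top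
  let ν := μ.withDensity d
  have : IsFiniteMeasure ν := isFiniteMeasure_withDensity_ofReal hi.2
  have hch : ∀ x : ℝ, charFun ν x = complexMGF id μ (s₀ + x * I) := by
    intro x
    rw [charFun_apply_real, integral_withDensity_eq_integral_toReal_smul hd hdt, complexMGF]
    congr 1
    ext t
    simp only [d, ENNReal.toReal_ofReal (Real.exp_pos _).le, real_smul, ofReal_exp, id]
    rw [← Complex.exp_add]
    congr 1
    push_cast
    ring
  have h1 : Integrable (fun t : ℝ => Real.exp (s * t)) ν := by
    refine aux_engine ν (fun z => G (s₀ + z * I)) R ?_ ?_ s hs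
    · refine hG.comp (by fun_prop) ?_
      intro z hz
      simpa using hz
    · have : ∀ᶠ x : ℝ in 𝓝 0, |x| < R := by
        have := (continuous_abs.tendsto (0 : ℝ)).eventually_lt_const (u := R) (by simpa using hR)
        exact this
      filter_upwards [this] with x hx
      rw [hch, heq]
      · simpa using hx
      · simpa using hs₀
  have h2 := (integrable_withDensity_iff_integrable_smul' hd hdt).1 h1
  refine h2.congr (.of_forall fun t => ?_)
  simp only [d, ENNReal.toReal_ofReal (Real.exp_pos _).le, smul_eq_mul, id]
  rw [← Real.exp_add]
  congr 1
  ring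
lemma aux_pd_conj (f : ℝ → ℂ) (hpd : IsPosDefFun f) (x : ℝ) :
    f (-x) = (starRingEnd ℂ) (f x) ∧ (f 0).im = 0 ∧ 0 ≤ (f 0).re := by
  have h0 := hpd 1 (fun _ => 0) (fun _ => 1)
  have h1 := hpd 2 ![x, 0] ![1, 1]
  have h2 := hpd 2 ![x, 0] ![1, I]
  simp only [Fin.sum_univ_succ, Complex.nonneg_iff] at h0 h1 h2
  simp at h0 h1 h2
  refine ⟨?_, h0.2.symm, h0.1⟩
  apply Complex.ext
  · simp; linarith [h0.2, h2.2]
  · simp; linarith [h0.2, h1.2]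

lemma aux_pd_diff (f : ℝ → ℂ) (hpd : IsPosDefFun f) (h0 : f 0 = 1) (x y : ℝ) :
    ‖f x - f y‖ ^ 2 ≤ 2 - 2 * (f (x - y)).re := by
  have h := hpd 3 ![x, y, 0] ![1, -1, -(f x - f y)]
  have e1 : f (y - x) = (starRingEnd ℂ) (f (x - y)) := by
    rw [← (aux_pd_conj f hpd (x - y)).1]; congr 1; ring
  have e2 : f (-x) = (starRingEnd ℂ) (f x) := (aux_pd_conj f hpd x).1
  have e3 : f (-y) = (starRingEnd ℂ) (f y) := (aux_pd_conj f hpd y).1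
  simp only [Fin.sum_univ_succ, Complex.nonneg_iff] at h
  simp [e1, e2, e3, h0] at h
  rw [Complex.sq_norm, normSq_apply]
  simp only [sub_re, sub_im]
  nlinarith [h.1]

lemma aux_pd_bound (f : ℝ → ℂ) (hpd : IsPosDefFun f) (x : ℝ) : ‖f x‖ ≤ (f 0).re := by
  have h := hpd 2 ![x, 0] ![(‖f x‖ : ℂ), -(f x)]
  have e2 : f (-x) = (starRingEnd ℂ) (f x) := (aux_pd_conj f hpd x).1
  obtain ⟨-, e3, e4⟩ := aux_pd_conj f hpd x
  by_contra hc
  push Not at hc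
  have hn : 0 < ‖f x‖ := e4.trans_lt hc
  simp only [Fin.sum_univ_succ, Complex.nonneg_iff] at h
  simp [e2, e3] at h
  have h2 := Complex.sq_norm (f x)
  rw [normSq_apply] at h2
  have h3 : 0 ≤ 2 * ‖f x‖ ^ 2 * ((f 0).re - ‖f x‖) := by
    have := h.1
    have e : 2 * ‖f x‖ ^ 2 * ((f 0).re - ‖f x‖) =
      (f 0).re * ‖f x‖ ^ 2 + (f 0).re * ‖f x‖ ^ 2 - 2 * ‖f x‖ * ‖f x‖ ^ 2 := by ring
    rw [e]
    nth_rw 2 [h2]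
    nth_rw 2 [h2]
    nlinarith [h.1]
  have : 0 < 2 * ‖f x‖ ^ 2 := by positivity
  nlinarith

lemma aux_pd_cont (f : ℝ → ℂ) (hpd : IsPosDefFun f) (h0 : f 0 = 1) (hc : ContinuousAt f 0) :
    Continuous f := by
  rw [continuous_iff_continuousAt]
  intro x
  rw [ContinuousAt, tendsto_iff_norm_sub_tendsto_zero]
  have h1 : Tendsto (fun y : ℝ => 2 - 2 * (f (y - x)).re) (𝓝 x) (𝓝 0) := by
    have h2 : Tendsto (fun y : ℝ => y - x) (𝓝 x) (𝓝 0) := by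
      simpa using (continuous_sub_right x).tendsto x
    have h3 : Tendsto (fun y : ℝ => (f (y - x)).re) (𝓝 x) (𝓝 (f 0).re) :=
      (continuous_re.tendsto _).comp (hc.tendsto.comp h2)
    have h4 := (h3.const_mul 2).const_sub 2
    simpa [h0] using h4
  have h5 : Tendsto (fun y : ℝ => ‖f y - f x‖ ^ 2) (𝓝 x) (𝓝 0) :=
    squeeze_zero (fun _ => by positivity) (fun y => aux_pd_diff f hpd h0 y x) h1
  have h6 := h5.sqrt
  simpa using h6

lemma aux_limit (f : ℝ → ℂ) (h0 : f 0 = 1) (hf : ContinuousAt f 0) (M : ℕ → Measure ℝ)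
    [∀ n, IsFiniteMeasure (M n)] (c : ℕ → ℂ)
    (hlim : ∀ x, Tendsto (fun n => c n * charFun (M n) x) atTop (𝓝 (f x))) :
    ∃ μ : Measure ℝ, IsProbabilityMeasure μ ∧ ∀ x, charFun μ x = f x := by
  classical
  let p : ℕ → Measure ℝ := fun n => if M n = 0 then Measure.dirac 0 else ((M n) univ)⁻¹ • M n
  have hp : ∀ n, IsProbabilityMeasure (p n) := by
    intro n
    by_cases h : M n = 0
    · simp only [p, h, if_true]; infer_instance
    · have : NeZero (M n) := ⟨h⟩
      simp only [p, h, if_false]; infer_instance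
  have hm0 := hlim 0
  rw [h0] at hm0
  have hne : ∀ᶠ n in atTop, c n * charFun (M n) 0 ≠ 0 := hm0.eventually_ne one_ne_zero
  have hpl : ∀ x, Tendsto (fun n => charFun (p n) x) atTop (𝓝 (f x)) := by
    intro x
    have h1 := (hlim x).div hm0 one_ne_zero
    rw [div_one] at h1
    refine h1.congr' ?_
    filter_upwards [hne] with n hn
    have hM : M n ≠ 0 := by
      intro h; simp [h] at hn
    have hcn : c n ≠ 0 := left_ne_zero_of_mul hn
    simp only [Pi.div_apply, p, hM, if_false]
    rw [mul_div_mul_left _ _ hcn, charFun_zero]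
    simp only [charFun_apply_real]
    rw [integral_smul_measure]
    simp [Measure.real, div_eq_inv_mul]
  have htight := isTightMeasureSet_of_tendsto_charFun hf hpl
  let P : ℕ → ProbabilityMeasure ℝ := fun n => ⟨p n, hp n⟩
  have hcomp : IsCompact (closure (range P)) := by
    apply isCompact_closure_of_isTightMeasureSet
    convert htight using 1
    ext ν
    constructor
    · rintro ⟨_, ⟨n, rfl⟩, rfl⟩; exact ⟨n, rfl⟩
    · rintro ⟨n, rfl⟩; exact ⟨P n, ⟨n, rfl⟩, rfl⟩
  obtain ⟨μ, -, hμ⟩ := hcomp.exists_clusterPt (f := map P atTop)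
    (le_principal_iff.2 (by
      rw [mem_map]; exact univ_mem' fun n => subset_closure (mem_range_self n)))
  obtain ⟨U, hU, hUμ⟩ := mapClusterPt_iff_ultrafilter.1 hμ
  refine ⟨μ, inferInstance, fun x => ?_⟩
  rw [ProbabilityMeasure.tendsto_iff_forall_integral_rclike_tendsto ℂ] at hUμ
  have h2 := hUμ (BoundedContinuousFunction.innerProbChar x)
  have h3 : Tendsto (fun n => charFun (p n) x) U (𝓝 (charFun (μ : Measure ℝ) x)) := by
    simp_rw [charFun_eq_integral_innerProbChar]
    exact h2
  exact tendsto_nhds_unique h3 ((hpl x).mono_left hU)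
open ProbabilityTheory

lemma aux_sampling (K : ℝ → ℝ → ℂ) (hKc : Continuous (fun p : ℝ × ℝ => K p.1 p.2)) (B : ℝ)
    (hKb : ∀ x y, ‖K x y‖ ≤ B) (hK1 : ∀ x, K x x = 1)
    (hpos : ∀ (n : ℕ) (x : Fin n → ℝ), 0 ≤ ∑ k, ∑ l, K (x k) (x l))
    (P : Measure ℝ) [IsProbabilityMeasure P] :
    0 ≤ ∫ p, K p.1 p.2 ∂(P.prod P) := by
  set J := ∫ p, K p.1 p.2 ∂(P.prod P) with hJ
  have hintg : ∀ (n : ℕ) (k l : Fin n),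
      Integrable (fun x : Fin n → ℝ => K (x k) (x l)) (Measure.pi fun _ => P) := by
    intro n k l
    refine Integrable.of_bound (C := B) ?_ (.of_forall fun x => hKb _ _)
    exact (hKc.comp (f := fun x : Fin n → ℝ => (x k, x l)) (by fun_prop)).aestronglyMeasurable
  have hval : ∀ (n : ℕ) (k l : Fin n),
      ∫ x : Fin n → ℝ, K (x k) (x l) ∂(Measure.pi fun _ => P) = if k = l then 1 else J := by
    intro n k l
    split_ifs with hkl
    · subst hkl; simp [hK1]
    · have hind : iIndepFun (fun (i : Fin n) (ω : Fin n → ℝ) => ω i) (Measure.pi fun _ => P) :=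
        iIndepFun_pi (X := fun _ => id) (fun _ => aemeasurable_id)
      have h2 := (hind.indepFun hkl).map_prod_eq_prod_map_map (measurable_pi_apply k).aemeasurable (measurable_pi_apply l).aemeasurable
      have hk : ∀ k : Fin n, (Measure.pi fun _ : Fin n => P).map (fun ω => ω k) = P :=
        fun k => (measurePreserving_eval (fun _ : Fin n => P) k).map_eq
      rw [hk, hk] at h2
      rw [hJ, ← h2, integral_map (by fun_prop) hKc.aestronglyMeasurable]
  have hsum : ∀ n : ℕ, 0 ≤ ∑ k : Fin n, ∑ l : Fin n, (if k = l then (1 : ℂ) else J) := by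
    intro n
    have e : ∑ k : Fin n, ∑ l : Fin n, (if k = l then (1 : ℂ) else J)
        = ∫ x : Fin n → ℝ, ∑ k, ∑ l, K (x k) (x l) ∂(Measure.pi fun _ => P) := by
      rw [integral_finsetSum _ (fun k _ => integrable_finsetSum _ (fun l _ => hintg n k l))]
      refine Finset.sum_congr rfl fun k _ => ?_
      rw [integral_finsetSum _ (fun l _ => hintg n k l)]
      exact Finset.sum_congr rfl fun l _ => (hval n k l).symm
    rw [e]
    exact integral_nonneg (fun x => hpos n x)
  have hs2 : ∀ n : ℕ, ∑ k : Fin n, ∑ l : Fin n, (if k = l then (1 : ℂ) else J)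
      = n * (1 + (n - 1) * J) := by
    intro n
    have : ∀ k l : Fin n, (if k = l then (1 : ℂ) else J) = (if k = l then 1 - J else 0) + J := by
      intro k l; split_ifs <;> simp
    simp_rw [this, Finset.sum_add_distrib]
    simp
    ring
  rw [Complex.nonneg_iff]
  constructor
  · by_contra hc
    push Not at hc
    obtain ⟨n, hn⟩ := exists_nat_gt (1 / (-J.re))
    rw [div_lt_iff₀ (by linarith)] at hn
    have h3 := hsum (n + 1)
    rw [hs2, Complex.nonneg_iff] at h3
    have h4 := h3.1
    simp at h4
    have h5 : (0 : ℝ) < n + 1 := by positivity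
    nlinarith [mul_pos h5 (show 0 < -(1 + n * J.re) by linarith)]
  · have h3 := hsum 2
    rw [hs2, Complex.nonneg_iff] at h3
    have h4 := h3.2
    norm_num at h4
    linarith

lemma aux_gauss_sub (v : NNReal) :
    ((gaussianReal 0 v).prod (gaussianReal 0 v)).map (fun p => p.1 - p.2)
      = gaussianReal 0 (v + v) := by
  have h1 : (fun p : ℝ × ℝ => p.1 - p.2) = (fun p : ℝ × ℝ => p.1 + p.2) ∘ (Prod.map id Neg.neg) := by
    ext p; simp [sub_eq_add_neg]
  rw [h1, ← Measure.map_map (by fun_prop) (by fun_prop),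
    ← Measure.map_prod_map _ _ (by fun_prop) (by fun_prop), Measure.map_id]
  have h2 : (gaussianReal 0 v).map (Neg.neg) = gaussianReal 0 v := by
    have := gaussianReal_map_neg (μ := 0) (v := v)
    simpa using this
  rw [h2]
  have := gaussianReal_conv_gaussianReal (m₁ := 0) (m₂ := 0) (v₁ := v) (v₂ := v)
  rw [Measure.conv] at this
  simpa using this

lemma aux_q_nonneg (f : ℝ → ℂ) (hpd : IsPosDefFun f) (h0 : f 0 = 1) (hc : Continuous f)
    (v : NNReal) (t : ℝ) :
    0 ≤ ∫ u, f u * cexp (-(t * u) * I) ∂(gaussianReal 0 (v + v)) := by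
  rw [← aux_gauss_sub, integral_map (by fun_prop) (by fun_prop)]
  refine aux_sampling (fun x y => f (x - y) * cexp (-(t * (x - y : ℝ)) * I)) (by fun_prop) 1 ?_ ?_ ?_ _
  · intro x y
    have h1 := aux_pd_bound f hpd (x - y)
    rw [h0] at h1
    have h2 : ‖cexp (-(t * (x - y : ℝ)) * I)‖ = 1 := by
      rw [← ofReal_mul, ← ofReal_neg, norm_exp_ofReal_mul_I]
    rw [norm_mul, h2]
    simpa using h1
  · intro x; simp [h0]
  · intro n x
    refine (hpd n x (fun k => cexp (-(t * x k) * I))).trans_eq ?_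
    refine Finset.sum_congr rfl fun k _ => Finset.sum_congr rfl fun l _ => ?_
    rw [← Complex.exp_conj, mul_assoc, ← Complex.exp_add]
    congr 2
    simp
    ring

lemma aux_key (f : ℝ → ℂ) (m : ℝ) (hm : 0 < m) (W : NNReal) (hW : (W : ℝ) = m ^ 2) (x : ℝ) :
    ((m ^ 2 : ℝ) : ℂ) * ∫ u, f u * cexp (-(W * (x - u) ^ 2 / 2 : ℝ)) ∂(gaussianReal 0 W) =
      ∫ z, f (x + z / m) * cexp (-((x + z / m) ^ 2 / (2 * m ^ 2) : ℝ)) ∂(gaussianReal 0 1) := by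
  have hW0 : W ≠ 0 := by
    intro h
    rw [h] at hW
    have : 0 < m ^ 2 := by positivity
    rw [NNReal.coe_zero] at hW
    exact this.ne hW
  rw [integral_gaussianReal_eq_integral_smul hW0,
    integral_gaussianReal_eq_integral_smul one_ne_zero]
  set G : ℝ → ℂ := fun u => (((√(2 * π))⁻¹ * Real.exp (-(m * (u - x)) ^ 2 / 2) : ℝ) : ℂ) *
    (f u * cexp (-(u ^ 2 / (2 * m ^ 2) : ℝ))) with hG
  have hR : (∫ z, gaussianPDFReal 0 1 z •
      (f (x + z / m) * cexp (-((x + z / m) ^ 2 / (2 * m ^ 2) : ℝ)))) = ∫ z, G (x + z / m) := by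
    congr 1
    ext z
    simp only [hG, gaussianPDFReal, Complex.real_smul]
    have : m * (x + z / m - x) = z := by field_simp; ring
    rw [this]
    simp
  rw [hR, Measure.integral_comp_div (fun y => G (x + y)) m, integral_add_left_eq_self G x,
    abs_of_pos hm, Complex.real_smul, ← integral_const_mul, ← integral_const_mul]
  congr 1
  ext u
  simp only [hG, gaussianPDFReal, Complex.real_smul, hW]
  have h1 : √(2 * π * m ^ 2) = √(2 * π) * m := by
    rw [Real.sqrt_mul (by positivity), Real.sqrt_sq hm.le]
  rw [h1]
  have h2 : (√(2 * π)) ≠ 0 := by positivity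
  push_cast
  have e1 : cexp (-(m * (u - x)) ^ 2 / 2) = cexp (-(m ^ 2 * (x - u) ^ 2 / 2)) := by
    congr 1; ring
  have e2 : cexp (-(u - 0) ^ 2 / (2 * m ^ 2)) = cexp (-(u ^ 2 / (2 * m ^ 2))) := by
    congr 1; ring
  rw [e1, e2]
  have h3 : (m : ℂ) ≠ 0 := by exact_mod_cast hm.ne'
  have h4 : ((√(2 * π) : ℝ) : ℂ) ≠ 0 := by exact_mod_cast h2
  field_simp

lemma aux_bochner (f : ℝ → ℂ) (hpd : IsPosDefFun f) (h0 : f 0 = 1) (hc0 : ContinuousAt f 0) :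
    ∃ μ : Measure ℝ, IsProbabilityMeasure μ ∧ ∀ x, charFun μ x = f x := by
  have hc : Continuous f := aux_pd_cont f hpd h0 hc0
  have hb : ∀ x, ‖f x‖ ≤ 1 := fun x => by
    have := aux_pd_bound f hpd x
    rwa [h0, Complex.one_re] at this
  set W : ℕ → NNReal := fun n => ((n : NNReal) + 1) ^ 2 with hW
  have hWr : ∀ n, ((W n : NNReal) : ℝ) = ((n : ℝ) + 1) ^ 2 := fun n => by simp [hW]
  set q : ℕ → ℝ → ℂ := fun n t => ∫ u, f u * cexp (-(t * u) * I) ∂(gaussianReal 0 (W n)) with hq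
  have hexp : ∀ a b : ℝ, ‖cexp (-(a * b) * I)‖ = 1 := fun a b => by
    have := Complex.norm_exp_ofReal_mul_I (-(a * b))
    push_cast at this
    exact this
  have hexp2 : ∀ a b : ℝ, ‖cexp (a * b * I)‖ = 1 := fun a b => by
    have := Complex.norm_exp_ofReal_mul_I (a * b)
    push_cast at this
    exact this
  have hqpos : ∀ n t, 0 ≤ q n t := fun n t => by
    have := aux_q_nonneg f hpd h0 hc (W n / 2) t
    rwa [add_halves] at this
  have hqre : ∀ n t, (((q n t).re : ℝ) : ℂ) = q n t := fun n t => by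
    have := hqpos n t
    rw [Complex.le_def] at this
    apply Complex.ext
    · simp
    · simpa using this.2
  have hqre0 : ∀ n t, 0 ≤ (q n t).re := fun n t => by
    have := hqpos n t
    rw [Complex.le_def] at this
    simpa using this.1
  have hqb : ∀ n t, ‖q n t‖ ≤ 1 := fun n t => by
    have := norm_integral_le_of_norm_le_const (μ := gaussianReal 0 (W n)) (C := 1)
      (f := fun u => f u * cexp (-(t * u) * I)) (ae_of_all _ fun u => by
        rw [norm_mul, hexp, mul_one]; exact hb u)
    rw [probReal_univ, mul_one] at this
    exact this
  have hqc : ∀ n, Continuous (q n) := fun n => by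
    apply continuous_of_dominated (bound := fun _ => (1 : ℝ))
    · intro t
      exact (by fun_prop : Continuous fun u : ℝ => f u * cexp (-(t * u) * I)).aestronglyMeasurable
    · intro t
      refine ae_of_all _ fun u => ?_
      rw [norm_mul, hexp, mul_one]; exact hb u
    · exact integrable_const _
    · refine ae_of_all _ fun u => ?_
      fun_prop
  have hqi : ∀ n, Integrable (fun t => (q n t).re) (gaussianReal 0 (W n)) := fun n => by
    apply Integrable.of_bound (C := 1)
    · exact (Complex.continuous_re.comp (hqc n)).aestronglyMeasurable
    · exact ae_of_all _ fun t => (Complex.abs_re_le_norm _).trans (hqb n t)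
  set M : ℕ → Measure ℝ := fun n =>
    (gaussianReal 0 (W n)).withDensity (fun t => ENNReal.ofReal (q n t).re) with hM
  have hMf : ∀ n, IsFiniteMeasure (M n) := fun n =>
    isFiniteMeasure_withDensity_ofReal (hqi n).2
  have hchar : ∀ n x, charFun (M n) x =
      ∫ u, f u * cexp (-(W n * (x - u) ^ 2 / 2 : ℝ)) ∂(gaussianReal 0 (W n)) := fun n x => by
    rw [charFun_apply_real]
    simp only [hM]
    have hmeas : Measurable (fun t => ENNReal.ofReal (q n t).re) :=
      ENNReal.measurable_ofReal.comp (Complex.measurable_re.comp (hqc n).measurable)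
    rw [integral_withDensity_eq_integral_toReal_smul hmeas
      (ae_of_all _ fun t => ENNReal.ofReal_lt_top)]
    have s1 : ∀ t : ℝ, (ENNReal.ofReal (q n t).re).toReal • cexp (x * t * I) =
        ∫ u, f u * cexp (-(t * u) * I) * cexp (x * t * I) ∂(gaussianReal 0 (W n)) := fun t => by
      rw [ENNReal.toReal_ofReal (hqre0 n t), Complex.real_smul, hqre, integral_mul_const]
    simp_rw [s1]
    rw [integral_integral_swap]
    · congr 1
      ext u
      have s2 : ∀ t : ℝ, f u * cexp (-(t * u) * I) * cexp (x * t * I) =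
          f u * cexp (((x - u : ℝ) : ℂ) * t * I) := fun t => by
        rw [mul_assoc, ← Complex.exp_add]
        congr 2
        push_cast
        ring
      simp_rw [s2]
      rw [integral_const_mul, ← charFun_apply_real, charFun_gaussianReal]
      congr 2
      push_cast
      ring
    · apply Integrable.of_bound (C := 1)
      · apply Continuous.aestronglyMeasurable
        simp only [Function.uncurry_def]
        fun_prop
      · refine ae_of_all _ fun p => ?_
        simp only [Function.uncurry_def]
        rw [norm_mul, norm_mul, hexp, hexp2, mul_one, mul_one]
        exact hb _
  refine aux_limit f h0 hc0 M (fun n => ((((n : ℝ) + 1) ^ 2 : ℝ) : ℂ)) fun x => ?_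
  have hform : ∀ n : ℕ, ((((n : ℝ) + 1) ^ 2 : ℝ) : ℂ) * charFun (M n) x =
      ∫ z, f (x + z / ((n : ℝ) + 1)) *
        cexp (-((x + z / ((n : ℝ) + 1)) ^ 2 / (2 * ((n : ℝ) + 1) ^ 2) : ℝ))
        ∂(gaussianReal 0 1) := fun n => by
    rw [hchar, aux_key f ((n : ℝ) + 1) (by positivity) (W n) (hWr n) x]
  simp_rw [hform]
  have hlimc : f x = ∫ z : ℝ, f x ∂(gaussianReal 0 1) := by simp
  rw [hlimc]
  apply tendsto_integral_of_dominated_convergence (fun _ => (1 : ℝ))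
  · intro n
    apply Continuous.aestronglyMeasurable
    fun_prop
  · exact integrable_const _
  · intro n
    refine ae_of_all _ fun z => ?_
    rw [norm_mul]
    refine mul_le_one₀ (hb _) (norm_nonneg _) ?_
    rw [Complex.norm_exp]
    apply Real.exp_le_one_iff.2
    rw [← Complex.ofReal_neg, Complex.ofReal_re]
    rw [neg_nonpos]
    positivity
  · refine ae_of_all _ fun z => ?_
    have t0 : Tendsto (fun n : ℕ => 1 / ((n : ℝ) + 1)) atTop (𝓝 0) :=
      tendsto_one_div_add_atTop_nhds_zero_nat
    have key : Continuous fun e : ℝ => f (x + z * e) * cexp (-((x + z * e) ^ 2 * e ^ 2 / 2 : ℝ)) := by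
      fun_prop
    have := (key.tendsto 0).comp t0
    simp only [mul_zero, add_zero, ne_eq, OfNat.ofNat_ne_zero, not_false_eq_true, zero_pow,
      zero_div, Complex.ofReal_zero, neg_zero, Complex.exp_zero, mul_one] at this
    refine this.congr fun n => ?_
    simp only [Function.comp]
    have hn : ((n : ℝ) + 1) ≠ 0 := by positivity
    congr 2
    · congr 1; ring
    · congr 2; field_simp

lemma aux_complexify (f : ℝ → ℂ) (hf : AnalyticAt ℝ f 0) :
    ∃ (R : ℝ) (F : ℂ → ℂ), 0 < R ∧ DifferentiableOn ℂ F (Metric.ball 0 R) ∧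
      ∀ᶠ x : ℝ in 𝓝 0, f x = F x := by
  obtain ⟨p, r, hp⟩ := hf
  set q : FormalMultilinearSeries ℂ ℂ ℂ := FormalMultilinearSeries.ofScalars ℂ (fun n => p.coeff n)
    with hq
  have hnorm : ∀ n, ‖q n‖ = ‖p n‖ := fun n => by
    rw [FormalMultilinearSeries.norm_apply_eq_norm_coef,
      FormalMultilinearSeries.norm_apply_eq_norm_coef, hq, FormalMultilinearSeries.coeff_ofScalars]
  have hrad : p.radius ≤ q.radius := FormalMultilinearSeries.radius_le_of_le fun n => (hnorm n).le
  have hqpos : 0 < q.radius := lt_of_lt_of_le (lt_of_lt_of_le hp.r_pos hp.r_le) hrad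
  have hqs := q.hasFPowerSeriesOnBall hqpos
  obtain ⟨R, hR0, hR⟩ : ∃ R : NNReal, 0 < R ∧ (R : ENNReal) < min r q.radius := by
    obtain ⟨R, h1, h2⟩ := ENNReal.lt_iff_exists_nnreal_btwn.1 (lt_min hp.r_pos hqpos)
    exact ⟨R, by exact_mod_cast h1, h2⟩
  have hsub : Metric.ball (0 : ℂ) R ⊆ Metric.eball 0 q.radius := by
    rw [← Metric.eball_coe]
    exact Metric.eball_subset_eball (hR.le.trans (min_le_right _ _))
  refine ⟨R, q.sum, by exact_mod_cast hR0, hqs.differentiableOn.mono hsub, ?_⟩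
  have hmem : Metric.ball (0 : ℝ) R ∈ 𝓝 (0 : ℝ) := Metric.ball_mem_nhds _ (by exact_mod_cast hR0)
  filter_upwards [hmem] with x hx
  have hx1 : x ∈ Metric.eball (0 : ℝ) r := by
    rw [← Metric.eball_coe] at hx
    exact Metric.eball_subset_eball (hR.le.trans (min_le_left _ _)) hx
  have hx2 : (x : ℂ) ∈ Metric.eball (0 : ℂ) q.radius := by
    apply hsub
    simpa using hx
  have s1 := hp.hasSum hx1
  have s2 := hqs.hasSum hx2
  rw [zero_add] at s1 s2
  refine s1.unique ?_
  convert s2 using 2 with n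
  rw [FormalMultilinearSeries.apply_eq_pow_smul_coeff,
    FormalMultilinearSeries.apply_eq_pow_smul_coeff, hq, FormalMultilinearSeries.coeff_ofScalars]
  simp [Complex.real_smul]

lemma aux_measure (f : ℝ → ℂ) (hpd : IsPosDefFun f) (hc : ContinuousAt f 0) :
    ∃ μ : Measure ℝ, IsFiniteMeasure μ ∧ ∀ x, charFun μ x = f x := by
  obtain ⟨hconj, him, hre⟩ := aux_pd_conj f hpd 0
  rcases hre.eq_or_lt with h | h
  · refine ⟨0, inferInstance, fun x => ?_⟩
    have hb := aux_pd_bound f hpd x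
    rw [← h] at hb
    have : f x = 0 := norm_le_zero_iff.1 hb
    simp [this, charFun_apply_real]
  · set c : ℝ := (f 0).re with hcdef
    have hf0 : f 0 = (c : ℂ) := Complex.ext (by simp [hcdef]) (by simpa using him)
    have hcne : (c : ℂ) ≠ 0 := by exact_mod_cast h.ne'
    obtain ⟨μ, hμ, hch⟩ := aux_bochner (fun x => ((c⁻¹ : ℝ) : ℂ) * f x) (by
      intro n x ξ
      have := hpd n x ξ
      have h2 : (0 : ℂ) ≤ ((c⁻¹ : ℝ) : ℂ) := by
        exact_mod_cast (inv_pos.2 h).le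
      have h3 := mul_nonneg h2 this
      rw [Finset.mul_sum] at h3
      simp_rw [Finset.mul_sum] at h3
      simpa only [mul_assoc] using h3) (by
        simp only [hf0]; push_cast; field_simp) (by fun_prop)
    refine ⟨ENNReal.ofReal c • μ, ?_, fun x => ?_⟩
    · exact Measure.smul_finite μ ENNReal.ofReal_ne_top
    · have := hch x
      rw [charFun_apply_real] at this ⊢
      rw [integral_smul_measure, this, ENNReal.toReal_ofReal h.le, Complex.real_smul]
      push_cast
      field_simp

lemma aux_interior (μ : Measure ℝ) (s : ℝ) :
    s ∈ interior (integrableExpSet id μ) ↔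
      ∃ a ∈ integrableExpSet id μ, ∃ b ∈ integrableExpSet id μ, a < s ∧ s < b := by
  constructor
  · intro h
    obtain ⟨ε, hε, hb⟩ := Metric.mem_nhds_iff.1 (mem_interior_iff_mem_nhds.1 h)
    refine ⟨s - ε / 2, hb ?_, s + ε / 2, hb ?_, by linarith, by linarith⟩
    · rw [Metric.mem_ball, Real.dist_eq, abs_lt]
      constructor <;> linarith
    · rw [Metric.mem_ball, Real.dist_eq, abs_lt]
      constructor <;> linarith
  · rintro ⟨a, ha, b, hb, h1, h2⟩
    have hsub : Set.Ioo a b ⊆ integrableExpSet id μ :=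
      Set.Ioo_subset_Icc_self.trans (convex_integrableExpSet.ordConnected.out ha hb)
    exact interior_maximal hsub isOpen_Ioo ⟨h1, h2⟩

lemma aux_strip (μ : Measure ℝ) (z : ℂ) :
    z ∈ HStrip (-(sSup ((fun s : ℝ => (s : EReal)) '' integrableExpSet id μ)))
      (sSup ((fun s : ℝ => ((-s : ℝ) : EReal)) '' integrableExpSet id μ)) ↔
    (I * z).re ∈ interior (integrableExpSet id μ) := by
  have hre : (I * z).re = -z.im := by simp
  rw [hre, aux_interior]
  simp only [HStrip, Set.mem_setOf_eq]
  rw [EReal.neg_lt_comm, lt_sSup_iff, lt_sSup_iff]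
  simp only [Set.exists_mem_image, ← EReal.coe_neg, EReal.coe_lt_coe_iff]
  constructor
  · rintro ⟨⟨b, hb, h1⟩, a, ha, h2⟩
    exact ⟨a, ha, b, hb, by linarith, h1⟩
  · rintro ⟨a, ha, b, hb, h1, h2⟩
    exact ⟨⟨b, hb, h2⟩, a, ha, by linarith⟩

lemma aux_extend (μ : Measure ℝ) (g : ℂ → ℂ) (V : Set ℂ) (hV : IsOpen V) (e : ℝ)
    (heV : -((e : ℂ) * I) ∈ V) (hg : DifferentiableOn ℂ g V)
    (heq : ∀ z ∈ V, (I * z).re ∈ interior (integrableExpSet id μ) →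
      g z = complexMGF id μ (I * z)) :
    ∃ ρ > 0, ∀ s₀ ∈ interior (integrableExpSet id μ), |s₀ - e| < ρ →
      ∀ s, |s| < 2 * ρ → s₀ + s ∈ integrableExpSet id μ := by
  obtain ⟨ρ, hρ, hb⟩ := Metric.isOpen_iff.1 hV _ heV
  have hmap : ∀ w : ℂ, dist w e < ρ → -(I * w) ∈ V := fun w hw => by
    apply hb
    rw [Metric.mem_ball, dist_eq_norm] at *
    have : -(I * w) - -((e : ℂ) * I) = -I * (w - e) := by ring
    rw [this, norm_mul]
    simpa using hw
  refine ⟨ρ / 3, by positivity, fun s₀ hs₀ hd s hs => ?_⟩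
  have hballs : ∀ w ∈ Metric.ball (s₀ : ℂ) (2 * (ρ / 3)), dist w e < ρ := fun w hw => by
    rw [Metric.mem_ball] at hw
    have h1 : dist (s₀ : ℂ) e < ρ / 3 := by
      rw [dist_eq_norm, ← Complex.ofReal_sub, Complex.norm_real]
      exact hd
    have := dist_triangle w (s₀ : ℂ) e
    linarith
  have hII : ∀ w : ℂ, I * -(I * w) = w := fun w => by
    rw [mul_neg, ← mul_assoc, I_mul_I]; ring
  refine aux_landau μ s₀ hs₀ (fun w => g (-(I * w))) (2 * (ρ / 3)) (by positivity) ?_ ?_ s hs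
  · refine hg.comp (by fun_prop) fun w hw => hmap w (hballs w hw)
  · intro w hw hwi
    have := heq (-(I * w)) (hmap w (hballs w hw)) (by rwa [hII])
    rwa [hII] at this

/-- A positive definite `f : ℝ → ℂ` that is real-analytic near the origin is real-analytic on
all of `ℝ` and extends, via the Fourier–Laplace transform of a finite nonnegative measure, to a
holomorphic function on a maximal horizontal strip `S_{-α,β}`: if the boundary is finite, no
holomorphic extension past the corresponding boundary point `-iα` (resp. `iβ`) exists. -/
theorem stmt1 (f : ℝ → ℂ) (hpd : IsPosDefFun f)
    (U : Set ℝ) (hU : IsOpen U) (h0 : (0 : ℝ) ∈ U)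
    (hana : ∀ x ∈ U, AnalyticAt ℝ f x) :
    (∀ x : ℝ, AnalyticAt ℝ f x) ∧
    ∃ (α β : EReal) (μ : Measure ℝ), IsFiniteMeasure μ ∧ 0 < α ∧ 0 < β ∧
      (∀ z ∈ HStrip (-α) β, Integrable (fun t : ℝ => Complex.exp (I * z * t)) μ) ∧
      DifferentiableOn ℂ (fun z => ∫ t : ℝ, Complex.exp (I * z * t) ∂μ) (HStrip (-α) β) ∧
      (∀ x : ℝ, (∫ t : ℝ, Complex.exp (I * (x : ℂ) * t) ∂μ) = f x) ∧
      (∀ αr : ℝ, α = (αr : EReal) →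
        ¬ ∃ (g : ℂ → ℂ) (V : Set ℂ), IsOpen V ∧ (-(αr : ℂ) * I) ∈ V ∧
            DifferentiableOn ℂ g V ∧
            Set.EqOn g (fun z => ∫ t : ℝ, Complex.exp (I * z * t) ∂μ) (V ∩ HStrip (-α) β)) ∧
      (∀ βr : ℝ, β = (βr : EReal) →
        ¬ ∃ (g : ℂ → ℂ) (V : Set ℂ), IsOpen V ∧ ((βr : ℂ) * I) ∈ V ∧
            DifferentiableOn ℂ g V ∧
            Set.EqOn g (fun z => ∫ t : ℝ, Complex.exp (I * z * t) ∂μ) (V ∩ HStrip (-α) β)) := by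
  have hana0 : AnalyticAt ℝ f 0 := hana 0 h0
  obtain ⟨μ, hμ, hch⟩ := aux_measure f hpd hana0.continuousAt
  obtain ⟨R, F, hR, hF, hfF⟩ := aux_complexify f hana0
  have hball : Metric.ball (0 : ℝ) R ⊆ integrableExpSet id μ := fun s hs => by
    rw [Metric.mem_ball, Real.dist_eq, sub_zero] at hs
    exact aux_engine μ F R hF (hfF.mono fun x hx => by rw [hch, hx]) s hs
  have hzint : (0 : ℝ) ∈ interior (integrableExpSet id μ) :=
    interior_maximal hball Metric.isOpen_ball (Metric.mem_ball_self hR)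
  obtain ⟨a, ha, b, hb, ha0, hb0⟩ := (aux_interior μ 0).1 hzint
  have hmgf : ∀ z : ℂ, (∫ t : ℝ, Complex.exp (I * z * t) ∂μ) = complexMGF id μ (I * z) :=
    fun z => rfl
  have hfx : ∀ x : ℝ, (∫ t : ℝ, Complex.exp (I * (x : ℂ) * t) ∂μ) = f x := fun x => by
    rw [← hch, charFun_apply_real]
    congr 1
    ext t
    congr 1
    ring
  have hIx : ∀ x : ℝ, (I * (x : ℂ)).re = 0 := fun x => by simp
  refine ⟨fun x => ?_, sSup ((fun s : ℝ => (s : EReal)) '' integrableExpSet id μ),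
    sSup ((fun s : ℝ => ((-s : ℝ) : EReal)) '' integrableExpSet id μ), μ, hμ, ?_, ?_, ?_, ?_,
    hfx, ?_, ?_⟩
  · have h1 : AnalyticAt ℂ (complexMGF id μ) (I * (x : ℂ)) :=
      analyticAt_complexMGF (by rw [hIx]; exact hzint)
    have h2 : AnalyticAt ℝ (fun y : ℝ => I * (y : ℂ)) x :=
      analyticAt_const.mul (Complex.ofRealCLM.analyticAt x)
    have h3 : AnalyticAt ℝ (fun y : ℝ => complexMGF id μ (I * (y : ℂ))) x :=
      AnalyticAt.fun_comp (g := complexMGF id μ) h1.restrictScalars h2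
    refine h3.congr (Eventually.of_forall fun y => ?_)
    show complexMGF id μ (I * (y : ℂ)) = f y
    rw [← hmgf, hfx]
  · exact lt_of_lt_of_le (b := ((b : ℝ) : EReal)) (by exact_mod_cast hb0) (le_sSup ⟨b, hb, rfl⟩)
  · refine lt_of_lt_of_le (b := ((-a : ℝ) : EReal)) ?_ (le_sSup ⟨a, ha, rfl⟩)
    have : (0 : ℝ) < -a := by linarith
    exact_mod_cast this
  · intro z hz
    rw [aux_strip] at hz
    exact integrable_cexp_mul_of_re_mem_integrableExpSet aemeasurable_id (interior_subset hz)
  · intro z hz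
    rw [aux_strip] at hz
    have h1 : DifferentiableAt ℂ (complexMGF id μ) (I * z) := (hasDerivAt_complexMGF hz).differentiableAt
    have h2 : DifferentiableAt ℂ (fun z => complexMGF id μ (I * z)) z :=
      DifferentiableAt.fun_comp' z h1 (by fun_prop)
    exact h2.differentiableWithinAt
  · rintro e he ⟨g, V, hV, heV, hg, hgeq⟩
    obtain ⟨ρ, hρ, key⟩ := aux_extend μ g V hV e (by simpa using heV) hg fun z hz hzi =>
      hgeq ⟨hz, (aux_strip μ z).2 hzi⟩
    have hle : ∀ s ∈ integrableExpSet id μ, s ≤ e := fun s hs => by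
      have : (s : EReal) ≤ (e : EReal) := by rw [← he]; exact le_sSup ⟨s, hs, rfl⟩
      exact_mod_cast this
    have hlt : ((e - min ρ e / 2 : ℝ) : EReal) <
        sSup ((fun s : ℝ => (s : EReal)) '' integrableExpSet id μ) := by
      rw [he, EReal.coe_lt_coe_iff]
      have := lt_min hρ (hb0.trans_le (hle b hb))
      linarith
    obtain ⟨_, ⟨c, hc, rfl⟩, hlt'⟩ := lt_sSup_iff.1 hlt
    rw [EReal.coe_lt_coe_iff] at hlt'
    have hmin := lt_min hρ (hb0.trans_le (hle b hb))
    have hm1 := min_le_left ρ e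
    have hm2 := min_le_right ρ e
    have := key (e - min ρ e / 2) ((aux_interior μ _).2 ⟨a, ha, c, hc, by linarith, hlt'⟩)
      (by rw [abs_lt]; constructor <;> linarith) ρ (by rw [abs_of_pos hρ]; linarith)
    have := hle _ this
    linarith
  · rintro e he ⟨g, V, hV, heV, hg, hgeq⟩
    obtain ⟨ρ, hρ, key⟩ := aux_extend μ g V hV (-e) (by simpa using heV) hg fun z hz hzi =>
      hgeq ⟨hz, (aux_strip μ z).2 hzi⟩
    have hle : ∀ s ∈ integrableExpSet id μ, -s ≤ e := fun s hs => by
      have : ((-s : ℝ) : EReal) ≤ (e : EReal) := by rw [← he]; exact le_sSup ⟨s, hs, rfl⟩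
      exact_mod_cast this
    have hmin : 0 < min ρ e := lt_min hρ (by have := hle a ha; linarith)
    have hlt : ((e - min ρ e / 2 : ℝ) : EReal) <
        sSup ((fun s : ℝ => ((-s : ℝ) : EReal)) '' integrableExpSet id μ) := by
      rw [he, EReal.coe_lt_coe_iff]
      linarith
    obtain ⟨_, ⟨c, hc, rfl⟩, hlt'⟩ := lt_sSup_iff.1 hlt
    rw [EReal.coe_lt_coe_iff] at hlt'
    have hm1 := min_le_left ρ e
    have hm2 := min_le_right ρ e
    have := key (-e + min ρ e / 2)
      ((aux_interior μ _).2 ⟨c, hc, b, hb, by linarith, by linarith⟩)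
      (by rw [abs_lt]; constructor <;> linarith) (-ρ) (by rw [abs_neg, abs_of_pos hρ]; linarith)
    have := hle _ this
    linarith
end
end

section
/- (Widder) Let a < b be extended reals and let G : (a,b) → ℝ. Then G is continuous and co-positive definite on (a,b) if and only if there exists a nonnegative Borel measure μ on ℝ such that for every y ∈ (a,b) the integral ∫ℝ e^{−yt} dμ(t) is finite and G(y) = ∫ℝ e^{−yt} dμ(t). -/
open Complex MeasureTheory Filter Set Topology
open scoped Real BigOperators ComplexOrder

noncomputable section

/-! ### Polynomials nonnegative on the half line -/

inductive SOSX : ℕ → Polynomial ℝ → Prop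
  | sq (n : ℕ) (q : Polynomial ℝ) (h : 2 * q.natDegree ≤ n) : SOSX n (q ^ 2)
  | xsq (n : ℕ) (q : Polynomial ℝ) (h : 2 * q.natDegree + 1 ≤ n) :
      SOSX n (Polynomial.X * q ^ 2)
  | add (n : ℕ) (p q : Polynomial ℝ) : SOSX n p → SOSX n q → SOSX n (p + q)

lemma SOSX.mono {n m : ℕ} {p : Polynomial ℝ} (h : SOSX n p) (hnm : n ≤ m) : SOSX m p := by
  induction h with
  | sq q h => exact .sq _ _ (by omega)
  | xsq q h => exact .xsq _ _ (by omega)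
  | add p q _ _ ih1 ih2 => exact .add _ _ _ ih1 ih2

lemma SOSX.mul {n m : ℕ} {p r : Polynomial ℝ} (hp : SOSX n p) (hr : SOSX m r) :
    SOSX (n + m) (p * r) := by
  induction hp with
  | add p q _ _ ih1 ih2 => rw [add_mul]; exact .add _ _ _ ih1 ih2
  | sq q h =>
    induction hr with
    | add p q _ _ ih1 ih2 => rw [mul_add]; exact .add _ _ _ ih1 ih2
    | sq q' h' =>
      rw [← mul_pow]
      have := Polynomial.natDegree_mul_le (p := q) (q := q')
      exact .sq _ _ (by omega)
    | xsq q' h' =>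
      have := Polynomial.natDegree_mul_le (p := q) (q := q')
      have e : q ^ 2 * (Polynomial.X * q' ^ 2) = Polynomial.X * (q * q') ^ 2 := by ring
      rw [e]
      exact .xsq _ _ (by omega)
  | xsq q h =>
    induction hr with
    | add p q _ _ ih1 ih2 => rw [mul_add]; exact .add _ _ _ ih1 ih2
    | sq q' h' =>
      have := Polynomial.natDegree_mul_le (p := q) (q := q')
      have e : Polynomial.X * q ^ 2 * (q' ^ 2) = Polynomial.X * (q * q') ^ 2 := by ring
      rw [e]
      exact .xsq _ _ (by omega)
    | xsq q' h' =>
      have := Polynomial.natDegree_mul_le (p := q) (q := q')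
      have h2 := Polynomial.natDegree_mul_le (p := Polynomial.X) (q := q * q')
      rw [Polynomial.natDegree_X] at h2
      have e : Polynomial.X * q ^ 2 * (Polynomial.X * q' ^ 2)
        = (Polynomial.X * (q * q')) ^ 2 := by ring
      rw [e]
      exact .sq _ _ (by omega)

lemma sosx_const (n : ℕ) (c : ℝ) (hc : 0 ≤ c) : SOSX n (Polynomial.C c) := by
  have : Polynomial.C c = (Polynomial.C (Real.sqrt c)) ^ 2 := by
    rw [← Polynomial.C_pow, Real.sq_sqrt hc]
  rw [this]
  exact .sq _ _ (by simp)

/-- sign of the values of a polynomial on `(0,∞)` minus a point extends to the point -/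
lemma poly_nonneg_of_punctured (p : Polynomial ℝ) (r : ℝ)
    (h : ∀ᶠ s in 𝓝[>] r, 0 ≤ p.eval s) : 0 ≤ p.eval r := by
  have : Tendsto (fun s => p.eval s) (𝓝[>] r) (𝓝 (p.eval r)) :=
    (p.continuous.tendsto r).mono_left nhdsWithin_le_nhds
  exact ge_of_tendsto this h

lemma poly_nonpos_of_punctured (p : Polynomial ℝ) (r : ℝ)
    (h : ∀ᶠ s in 𝓝[<] r, p.eval s ≤ 0) : p.eval r ≤ 0 := by
  have : Tendsto (fun s => p.eval s) (𝓝[<] r) (𝓝 (p.eval r)) :=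
    (p.continuous.tendsto r).mono_left nhdsWithin_le_nhds
  exact le_of_tendsto this h

lemma sosx_of_nonneg : ∀ (d : ℕ) (p : Polynomial ℝ), p.natDegree ≤ d →
    (∀ s : ℝ, 0 < s → 0 ≤ p.eval s) → SOSX p.natDegree p := by
  intro d
  induction d using Nat.strong_induction_on with
  | _ d ih =>
  intro p hd hp
  by_cases h0 : p.natDegree = 0
  · obtain ⟨c, rfl⟩ := Polynomial.natDegree_eq_zero.mp h0
    refine sosx_const _ _ ?_
    simpa using hp 1 one_pos
  have hpne : p ≠ 0 := by rintro rfl; simp at h0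
  obtain ⟨z, hz⟩ := Complex.exists_root (f := p.map (algebraMap ℝ ℂ)) (by
    rw [Polynomial.degree_map]
    exact Polynomial.natDegree_pos_iff_degree_pos.mp (Nat.pos_of_ne_zero h0))
  have hz' : Polynomial.aeval z p = 0 := by
    rwa [Polynomial.IsRoot.def, Polynomial.eval_map_algebraMap] at hz
  by_cases him : z.im = 0
  · -- real root
    obtain ⟨r, rfl⟩ : ∃ r : ℝ, z = (r : ℂ) := ⟨z.re, by apply Complex.ext <;> simp [him]⟩
    have hr : p.IsRoot r := by
      have := Polynomial.aeval_algebraMap_apply_eq_algebraMap_eval (A := ℂ) r p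
      simp only [Complex.coe_algebraMap] at this
      rw [hz'] at this
      exact_mod_cast this.symm
    obtain ⟨p1, rfl⟩ := Polynomial.dvd_iff_isRoot.mpr hr
    have hp1 : p1 ≠ 0 := right_ne_zero_of_mul hpne
    have hX : (Polynomial.X - Polynomial.C r) ≠ 0 := Polynomial.X_sub_C_ne_zero r
    have hdeg := Polynomial.natDegree_mul hX hp1
    rw [Polynomial.natDegree_X_sub_C] at hdeg
    rcases le_or_gt r 0 with hr0 | hr0
    · have h1 : SOSX p1.natDegree p1 := by
        refine ih p1.natDegree (by omega) p1 le_rfl fun s hs => ?_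
        have := hp s hs
        simp only [Polynomial.eval_mul, Polynomial.eval_sub, Polynomial.eval_X,
          Polynomial.eval_C] at this
        exact nonneg_of_mul_nonneg_right this (by linarith)
      rw [hdeg]
      refine SOSX.mul ?_ h1
      have e : (Polynomial.X - Polynomial.C r : Polynomial ℝ)
          = Polynomial.X * 1 ^ 2 + Polynomial.C (-r) := by
        simp [sub_eq_add_neg]
      rw [e]
      exact .add _ _ _ (.xsq _ _ (by simp)) (sosx_const _ _ (by linarith))
    · have hev : ∀ s, 0 < s → 0 ≤ (s - r) * p1.eval s := by
        intro s hs; simpa using hp s hs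
      have hroot : p1.eval r = 0 := by
        apply le_antisymm
        · apply poly_nonpos_of_punctured
          have : ∀ᶠ s in 𝓝[<] r, 0 < s :=
            nhdsWithin_le_nhds (eventually_gt_nhds hr0)
          filter_upwards [this, self_mem_nhdsWithin] with s hs hs'
          have := hev s hs
          have h3 : s - r < 0 := sub_neg.mpr hs'
          by_contra! h4
          nlinarith [mul_neg_of_neg_of_pos h3 h4]
        · apply poly_nonneg_of_punctured
          filter_upwards [self_mem_nhdsWithin] with s hs'
          exact nonneg_of_mul_nonneg_right (hev s (hr0.trans hs')) (sub_pos.mpr hs')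
      obtain ⟨p2, rfl⟩ := Polynomial.dvd_iff_isRoot.mpr hroot
      have hp2 : p2 ≠ 0 := right_ne_zero_of_mul hp1
      have hdeg2 := Polynomial.natDegree_mul hX hp2
      rw [Polynomial.natDegree_X_sub_C] at hdeg2
      have hev2 : ∀ s, 0 < s → s ≠ r → 0 ≤ p2.eval s := by
        intro s hs hsr
        have h5 := hev s hs
        simp only [Polynomial.eval_mul, Polynomial.eval_sub, Polynomial.eval_X,
          Polynomial.eval_C] at h5
        have h6 : 0 < (s - r) ^ 2 := by
          have := sub_ne_zero.mpr hsr
          positivity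
        refine nonneg_of_mul_nonneg_right (a := (s - r) ^ 2) ?_ h6
        nlinarith
      have h2 : SOSX p2.natDegree p2 := by
        refine ih p2.natDegree (by omega) p2 le_rfl fun s hs => ?_
        by_cases hsr : s = r
        · subst hsr
          apply poly_nonneg_of_punctured
          filter_upwards [self_mem_nhdsWithin] with u hu
          exact hev2 u (hs.trans hu) (ne_of_gt hu)
        · exact hev2 s hs hsr
      rw [hdeg, hdeg2]
      have e : (Polynomial.X - Polynomial.C r) * ((Polynomial.X - Polynomial.C r) * p2)
        = (Polynomial.X - Polynomial.C r) ^ 2 * p2 := by ring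
      rw [e, ← add_assoc]
      exact SOSX.mul (.sq _ _ (by simp)) h2
  · have hdvd := Polynomial.quadratic_dvd_of_aeval_eq_zero_im_ne_zero p hz' him
    have e : (Polynomial.X ^ 2 - Polynomial.C (2 * z.re) * Polynomial.X
        + Polynomial.C (‖z‖ ^ 2) : Polynomial ℝ)
        = (Polynomial.X - Polynomial.C z.re) ^ 2 + Polynomial.C (z.im ^ 2) := by
      rw [Complex.sq_norm, Complex.normSq_apply]
      simp only [map_mul, map_add, map_pow, map_ofNat]
      ring
    have hsos : SOSX 2 ((Polynomial.X - Polynomial.C z.re) ^ 2 + Polynomial.C (z.im ^ 2)) :=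
      .add _ _ _ (.sq _ _ (by simp)) (sosx_const _ _ (sq_nonneg _))
    have hd2 : (Polynomial.X ^ 2 - Polynomial.C (2 * z.re) * Polynomial.X
        + Polynomial.C (‖z‖ ^ 2) : Polynomial ℝ).natDegree = 2 := by
      compute_degree!
    rw [e] at hdvd hd2
    obtain ⟨p1, rfl⟩ := hdvd
    have hp1 : p1 ≠ 0 := right_ne_zero_of_mul hpne
    have hdeg := Polynomial.natDegree_mul (left_ne_zero_of_mul hpne) hp1
    rw [hd2] at hdeg
    rw [hdeg]
    refine SOSX.mul hsos (ih p1.natDegree (by omega) p1 le_rfl fun s hs => ?_)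
    have h5 := hp s hs
    rw [Polynomial.eval_mul] at h5
    refine nonneg_of_mul_nonneg_right h5 ?_
    simp only [Polynomial.eval_add, Polynomial.eval_pow, Polynomial.eval_sub, Polynomial.eval_X,
      Polynomial.eval_C]
    positivity

/-! ### Positivity of the functional on exponential sums -/

/-- The functional `X ^ j ↦ G (y + j h)`. -/
def gridFun (G : ℝ → ℝ) (y h : ℝ) : Polynomial ℝ →ₗ[ℝ] ℝ :=
  Polynomial.lsum (fun j => LinearMap.mulRight ℝ (G (y + j * h)))

lemma gridFun_monomial (G : ℝ → ℝ) (y h : ℝ) (j : ℕ) (c : ℝ) :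
    gridFun G y h (Polynomial.monomial j c) = c * G (y + j * h) := by
  simp [gridFun, Polynomial.lsum_apply, Polynomial.sum_monomial_index]

lemma gridFun_sq {G : ℝ → ℝ} {I : Set ℝ} (hG : IsCoPosDefOnR (fun x => (G x : ℂ)) I)
    {y h : ℝ} {n : ℕ} (hI : ∀ j : ℕ, j ≤ n → y + j * h ∈ I) (e : ℕ) (q : Polynomial ℝ)
    (hq : 2 * q.natDegree + e ≤ n) :
    0 ≤ gridFun G y h (Polynomial.X ^ e * q ^ 2) := by
  have hexp : gridFun G y h (Polynomial.X ^ e * q ^ 2) =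
      ∑ i : Fin (q.natDegree + 1), ∑ k : Fin (q.natDegree + 1),
        G (y + ((e + i + k : ℕ) : ℝ) * h) * q.coeff i * q.coeff k := by
    have h1 : Polynomial.X ^ e * q ^ 2 = ∑ i : Fin (q.natDegree + 1),
        ∑ k : Fin (q.natDegree + 1),
          Polynomial.monomial (e + i + k) (q.coeff i * q.coeff k) := by
      have h2 : q = ∑ i : Fin (q.natDegree + 1), Polynomial.monomial i (q.coeff i) := by
        conv_lhs => rw [q.as_sum_range]
        rw [Finset.sum_range]
      conv_lhs => rw [h2, sq, Finset.sum_mul_sum, Finset.mul_sum]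
      refine Finset.sum_congr rfl fun i _ => ?_
      rw [Finset.mul_sum]
      refine Finset.sum_congr rfl fun k _ => ?_
      rw [Polynomial.monomial_mul_monomial, Polynomial.X_pow_mul_monomial]
      congr 2
      omega
    rw [h1, map_sum]
    refine Finset.sum_congr rfl fun i _ => ?_
    rw [map_sum]
    refine Finset.sum_congr rfl fun k _ => ?_
    rw [gridFun_monomial]
    ring
  have hx : ∀ i k : Fin (q.natDegree + 1),
      (y / 2 + ((i : ℕ) + (e : ℝ) / 2) * h) + (y / 2 + ((k : ℕ) + (e : ℝ) / 2) * h)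
        = y + ((e + i + k : ℕ) : ℝ) * h := by
    intro i k; push_cast; ring
  have := hG (q.natDegree + 1) (fun i => y / 2 + ((i : ℕ) + (e : ℝ) / 2) * h)
    (by
      intro i k
      simp only [hx]
      exact hI _ (by have := i.2; have := k.2; omega))
    (fun i => (q.coeff i : ℂ))
  simp only [hx, Complex.conj_ofReal] at this
  rw [hexp]
  exact_mod_cast this

lemma gridFun_nonneg {G : ℝ → ℝ} {I : Set ℝ} (hG : IsCoPosDefOnR (fun x => (G x : ℂ)) I)
    {y h : ℝ} {n : ℕ} (hI : ∀ j : ℕ, j ≤ n → y + j * h ∈ I) (p : Polynomial ℝ)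
    (hp : SOSX n p) : 0 ≤ gridFun G y h p := by
  induction hp with
  | sq q hq => simpa using gridFun_sq hG hI 0 q (by omega)
  | xsq q hq => simpa using gridFun_sq hG hI 1 q (by omega)
  | add p q _ _ ih1 ih2 => rw [map_add]; exact add_nonneg ih1 ih2

lemma expsum_pos {G : ℝ → ℝ} {I : Set ℝ} (hG : IsCoPosDefOnR (fun x => (G x : ℂ)) I)
    (hI : I.OrdConnected) (c : {q : ℚ // (q : ℝ) ∈ I} →₀ ℝ)
    (hc : ∀ t : ℝ, 0 ≤ ∑ q ∈ c.support, c q * Real.exp (-(q.1 : ℝ) * t)) :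
    0 ≤ ∑ q ∈ c.support, c q * G (q.1 : ℝ) := by
  rcases c.support.eq_empty_or_nonempty with he | hne
  · simp [he]
  set N : ℕ := ∏ q ∈ c.support, q.1.den with hN
  have hN0 : 0 < N := Finset.prod_pos fun q _ => q.1.den_pos
  have hN0' : (0 : ℝ) < N := by exact_mod_cast hN0
  have hk : ∀ q : {q : ℚ // (q : ℝ) ∈ I}, ∃ k : ℤ, q ∈ c.support → (q.1 : ℝ) = k / N := by
    intro q
    by_cases hq : q ∈ c.support
    · obtain ⟨d, hd⟩ := Finset.dvd_prod_of_mem (fun q : {q : ℚ // (q : ℝ) ∈ I} => q.1.den) hq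
      refine ⟨q.1.num * d, fun _ => ?_⟩
      rw [← hN] at hd
      rw [hd] at hN0' ⊢
      have hd0 : (d : ℝ) ≠ 0 := by rintro h; simp [h] at hN0'
      have hq0 : (q.1.den : ℝ) ≠ 0 := by exact_mod_cast q.1.den_pos.ne'
      rw [Rat.cast_def]
      push_cast
      field_simp
    · exact ⟨0, fun h => absurd h hq⟩
  choose k hk using hk
  obtain ⟨q0, hq0, hmin⟩ := Finset.exists_min_image c.support k hne
  obtain ⟨q1, hq1, hmax⟩ := Finset.exists_max_image c.support k hne
  set p : Polynomial ℝ := ∑ q ∈ c.support, Polynomial.monomial (k q - k q0).toNat (c q) with hp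
  have hcast : ∀ q ∈ c.support, (((k q - k q0).toNat : ℕ) : ℝ) = k q - k q0 := by
    intro q hq
    have h1 : (((k q - k q0).toNat : ℕ) : ℤ) = k q - k q0 :=
      Int.toNat_of_nonneg (sub_nonneg.mpr (hmin q hq))
    exact_mod_cast h1
  have hdeg : p.natDegree ≤ (k q1 - k q0).toNat := by
    refine Polynomial.natDegree_sum_le_of_forall_le _ _ fun q hq => ?_
    refine (Polynomial.natDegree_monomial_le _).trans ?_
    exact Int.toNat_le_toNat (sub_le_sub_right (hmax q hq) _)
  have hpos : ∀ s : ℝ, 0 < s → 0 ≤ p.eval s := by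
    intro s hs
    have h1 := hc (-(N * Real.log s))
    have h2 : p.eval s = Real.exp (-(k q0) * Real.log s) *
        ∑ q ∈ c.support, c q * Real.exp (-(q.1 : ℝ) * (-(N * Real.log s))) := by
      rw [hp, Polynomial.eval_finsetSum, Finset.mul_sum]
      refine Finset.sum_congr rfl fun q hq => ?_
      rw [Polynomial.eval_monomial, mul_left_comm, ← Real.exp_add, ← Real.rpow_natCast,
        hcast q hq, Real.rpow_def_of_pos hs, hk q hq]
      congr 2
      field_simp
      ring
    rw [h2]
    exact mul_nonneg (Real.exp_pos _).le h1
  have hsos := (sosx_of_nonneg _ p le_rfl hpos).mono hdeg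
  have hgrid : ∀ j : ℕ, j ≤ (k q1 - k q0).toNat → (q0.1 : ℝ) + j * (1 / (N : ℝ)) ∈ I := by
    intro j hj
    refine hI.out q0.2 q1.2 ⟨by simp; positivity, ?_⟩
    have h1 : (j : ℝ) ≤ ((k q1 - k q0).toNat : ℕ) := by exact_mod_cast hj
    rw [hcast q1 hq1] at h1
    rw [hk q0 hq0, hk q1 hq1]
    field_simp
    linarith
  have := gridFun_nonneg hG hgrid p hsos
  rw [hp, map_sum] at this
  convert this using 1
  refine Finset.sum_congr rfl fun q hq => ?_
  rw [gridFun_monomial, hcast q hq, hk q0 hq0, hk q hq]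
  congr 2
  field_simp
  ring

/-! ### Extension of the functional -/

def expFun (y : ℝ) : ℝ → ℝ := fun t => Real.exp (-y * t)

def expLC (I : Set ℝ) : ({q : ℚ // (q : ℝ) ∈ I} →₀ ℝ) →ₗ[ℝ] (ℝ → ℝ) :=
  Finsupp.linearCombination ℝ (fun q : {q : ℚ // (q : ℝ) ∈ I} => expFun (q.1 : ℝ))

lemma expLC_apply (I : Set ℝ) (c : {q : ℚ // (q : ℝ) ∈ I} →₀ ℝ) (t : ℝ) :
    expLC I c t = ∑ q ∈ c.support, c q * Real.exp (-(q.1 : ℝ) * t) := by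
  simp [expLC, Finsupp.linearCombination_apply, Finsupp.sum, expFun, Finset.sum_apply]

lemma expLC_single (I : Set ℝ) (q : {q : ℚ // (q : ℝ) ∈ I}) (a : ℝ) (t : ℝ) :
    expLC I (Finsupp.single q a) t = a * Real.exp (-(q.1 : ℝ) * t) := by
  simp [expLC, expFun]

/-- Functions dominated by an exponential sum. -/
def expBdd (I : Set ℝ) : Submodule ℝ (ℝ → ℝ) where
  carrier := {f | ∃ c, ∀ t, |f t| ≤ expLC I c t}
  zero_mem' := ⟨0, fun t => by simp⟩
  add_mem' := by
    rintro f g ⟨c, hc⟩ ⟨d, hd⟩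
    refine ⟨c + d, fun t => ?_⟩
    rw [map_add]
    exact (abs_add_le _ _).trans (add_le_add (hc t) (hd t))
  smul_mem' := by
    rintro a f ⟨c, hc⟩
    refine ⟨|a| • c, fun t => ?_⟩
    rw [map_smul]
    simp only [Pi.smul_apply, smul_eq_mul, abs_mul]
    exact mul_le_mul_of_nonneg_left (hc t) (abs_nonneg a)

lemma expLC_mem (I : Set ℝ) (c : {q : ℚ // (q : ℝ) ∈ I} →₀ ℝ) : expLC I c ∈ expBdd I := by
  induction c using Finsupp.induction_linear with
  | zero => simp
  | add f g hf hg => rw [map_add]; exact add_mem hf hg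
  | single q a =>
    refine ⟨Finsupp.single q |a|, fun t => ?_⟩
    rw [expLC_single, expLC_single, abs_mul, abs_of_pos (Real.exp_pos _)]

/-- The pointwise nonnegative cone. -/
def nnCone (I : Set ℝ) : PointedCone ℝ (expBdd I) where
  carrier := {f | ∀ t, 0 ≤ f.1 t}
  zero_mem' := fun t => by simp
  add_mem' := fun {f g} hf hg t => by
    simpa using add_nonneg (hf t) (hg t)
  smul_mem' := fun a f hf t => mul_nonneg a.2 (hf t)

lemma exists_functional {G : ℝ → ℝ} {I : Set ℝ}
    (hG : IsCoPosDefOnR (fun x => (G x : ℂ)) I) (hI : I.OrdConnected) :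
    ∃ g : expBdd I →ₗ[ℝ] ℝ, (∀ f : expBdd I, (∀ t, 0 ≤ f.1 t) → 0 ≤ g f) ∧
      ∀ f : expBdd I, ∀ q : {q : ℚ // (q : ℝ) ∈ I}, f.1 = expFun (q.1 : ℝ) →
        g f = G (q.1 : ℝ) := by
  set Φ : ({q : ℚ // (q : ℝ) ∈ I} →₀ ℝ) →ₗ[ℝ] expBdd I :=
    (expLC I).codRestrict (expBdd I) (expLC_mem I) with hΦ
  set L : ({q : ℚ // (q : ℝ) ∈ I} →₀ ℝ) →ₗ[ℝ] ℝ :=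
    Finsupp.linearCombination ℝ (fun q : {q : ℚ // (q : ℝ) ∈ I} => G (q.1 : ℝ)) with hL
  have hLpos : ∀ c, (∀ t, 0 ≤ expLC I c t) → 0 ≤ L c := by
    intro c hc
    have := expsum_pos hG hI c (fun t => by rw [← expLC_apply]; exact hc t)
    simpa [hL, Finsupp.linearCombination_apply, Finsupp.sum] using this
  have hker : L ∈ (LinearMap.ker Φ).dualAnnihilator := by
    rw [Submodule.mem_dualAnnihilator]
    intro c hc
    have h0 : expLC I c = 0 := by
      have := congrArg Subtype.val (LinearMap.mem_ker.mp hc)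
      simpa [hΦ] using this
    apply le_antisymm
    · have := hLpos (-c) (fun t => by rw [map_neg, h0]; simp)
      rw [map_neg] at this
      linarith
    · exact hLpos c (fun t => by rw [h0]; simp)
  rw [← LinearMap.range_dualMap_eq_dualAnnihilator_ker] at hker
  obtain ⟨g0, hg0⟩ := hker
  have hg0' : ∀ c, g0 (Φ c) = L c := fun c => by rw [← hg0]; rfl
  obtain ⟨g, hg1, hg2⟩ := riesz_extension (nnCone I)
    ⟨LinearMap.range Φ, g0.comp (LinearMap.range Φ).subtype⟩
    (by
      rintro ⟨_, c, rfl⟩ hx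
      change 0 ≤ g0 (Φ c)
      rw [hg0']
      exact hLpos c hx)
    (by
      rintro ⟨f, c, hc⟩
      refine ⟨⟨Φ c, c, rfl⟩, fun t => ?_⟩
      have := hc t
      have h2 := neg_abs_le (f t)
      change 0 ≤ expLC I c t + f t
      linarith)
  refine ⟨g, fun f hf => hg2 f hf, fun f q hf => ?_⟩
  have h1 : f = Φ (Finsupp.single q 1) := by
    apply Subtype.ext
    rw [hf]
    funext t
    change _ = expLC I _ t
    rw [expLC_single, one_mul]
    rfl
  have h2 := hg1 ⟨Φ (Finsupp.single q 1), _, rfl⟩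
  rw [h1]
  refine h2.trans ?_
  change g0 (Φ _) = _
  rw [hg0']
  simp [hL]

/-! ### Passage to a measure -/

open CompactlySupported in
lemma cc_mem {I : Set ℝ} (q : {q : ℚ // (q : ℝ) ∈ I}) (f : C_c(ℝ, ℝ)) :
    (f : ℝ → ℝ) ∈ expBdd I := by
  have hcont : Continuous (fun t => Real.exp ((q.1 : ℝ) * t) * f t) := by
    have := f.continuous
    fun_prop
  have hs : HasCompactSupport (fun t => Real.exp ((q.1 : ℝ) * t) * f t) :=
    f.hasCompactSupport.mul_left
  obtain ⟨C, hC⟩ := hs.exists_bound_of_continuous hcont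
  refine ⟨Finsupp.single q C, fun t => ?_⟩
  rw [expLC_single]
  have h1 := hC t
  rw [Real.norm_eq_abs, abs_mul, abs_of_pos (Real.exp_pos _)] at h1
  have h2 := mul_le_mul_of_nonneg_right h1 (Real.exp_pos (-(q.1 : ℝ) * t)).le
  refine le_trans (le_of_eq ?_) h2
  rw [mul_right_comm, ← Real.exp_add]
  simp

/-- Cutoff functions. -/
def cutoff (n : ℕ) (t : ℝ) : ℝ := max 0 (min 1 (n + 1 - |t|))

lemma cutoff_nonneg (n : ℕ) (t : ℝ) : 0 ≤ cutoff n t := le_max_left _ _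
lemma cutoff_le_one (n : ℕ) (t : ℝ) : cutoff n t ≤ 1 := max_le zero_le_one (min_le_left _ _)
lemma cutoff_eq_one {n : ℕ} {t : ℝ} (h : |t| ≤ n) : cutoff n t = 1 := by
  unfold cutoff
  rw [min_eq_left (by linarith), max_eq_right zero_le_one]
lemma cutoff_mono (t : ℝ) : Monotone (fun n => cutoff n t) := by
  intro n m h
  have : (n : ℝ) ≤ m := by exact_mod_cast h
  exact max_le_max le_rfl (min_le_min le_rfl (by linarith))
lemma cutoff_continuous (n : ℕ) : Continuous (cutoff n) := by
  unfold cutoff; fun_prop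
lemma cutoff_supp (n : ℕ) : HasCompactSupport (cutoff n) := by
  refine HasCompactSupport.intro (isCompact_Icc (a := -((n : ℝ) + 1)) (b := n + 1)) ?_
  intro t ht
  have : (n : ℝ) + 1 < |t| := by
    by_contra! h
    exact ht (abs_le.mp h)
  unfold cutoff
  rw [max_eq_left]
  exact (min_le_right _ _).trans (by linarith)

lemma exists_measure_rat {G : ℝ → ℝ} {I : Set ℝ}
    (hG : IsCoPosDefOnR (fun x => (G x : ℂ)) I) (hI : I.OrdConnected) (hIo : IsOpen I)
    (hne : I.Nonempty) :
    ∃ μ : Measure ℝ, ∀ q : ℚ, (q : ℝ) ∈ I →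
      Integrable (fun t : ℝ => Real.exp (-(q : ℝ) * t)) μ ∧
      G q = ∫ t : ℝ, Real.exp (-(q : ℝ) * t) ∂μ := by
  obtain ⟨g, hg1, hg2⟩ := exists_functional hG hI
  obtain ⟨q00, hq00⟩ : ∃ q : ℚ, (q : ℝ) ∈ I := by
    obtain ⟨x, hx, q, rfl⟩ := (Rat.denseRange_cast (𝕜 := ℝ)).inter_open_nonempty I hIo hne
    exact ⟨q, hx⟩
  let emb : CompactlySupportedContinuousMap ℝ ℝ →ₗ[ℝ] expBdd I :=
    { toFun := fun f => ⟨f, cc_mem ⟨q00, hq00⟩ f⟩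
      map_add' := fun f g => rfl
      map_smul' := fun a f => rfl }
  let Λ : CompactlySupportedContinuousMap ℝ ℝ →ₚ[ℝ] ℝ :=
    PositiveLinearMap.mk₀ (g.comp emb) (fun f hf => hg1 _ hf)
  refine ⟨RealRMK.rieszMeasure Λ, fun q hq => ?_⟩
  set μ := RealRMK.rieszMeasure Λ with hμ
  -- room around `q`
  obtain ⟨ε, hε, hball⟩ := Metric.isOpen_iff.mp hIo q hq
  obtain ⟨δ, hδ0, hδ⟩ := exists_rat_btwn hε
  have hδ0' : (0 : ℝ) < δ := by exact_mod_cast hδ0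
  have hqm : ((q - δ : ℚ) : ℝ) ∈ I := hball (by
    rw [Metric.mem_ball, Real.dist_eq]; push_cast
    rw [abs_lt]; constructor <;> linarith)
  have hqp : ((q + δ : ℚ) : ℝ) ∈ I := hball (by
    rw [Metric.mem_ball, Real.dist_eq]; push_cast
    rw [abs_lt]; constructor <;> linarith)
  -- the elements
  have hmem : ∀ r : ℚ, (r : ℝ) ∈ I → expFun (r : ℝ) ∈ expBdd I := by
    intro r hr
    refine ⟨Finsupp.single ⟨r, hr⟩ 1, fun t => ?_⟩
    rw [expLC_single, expFun, abs_of_pos (Real.exp_pos _), one_mul]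
  let E : expBdd I := ⟨expFun (q : ℝ), hmem q hq⟩
  let Em : expBdd I := ⟨expFun ((q - δ : ℚ) : ℝ), hmem _ hqm⟩
  let Ep : expBdd I := ⟨expFun ((q + δ : ℚ) : ℝ), hmem _ hqp⟩
  have hE : g E = G q := hg2 E ⟨q, hq⟩ rfl
  let F : ℕ → CompactlySupportedContinuousMap ℝ ℝ := fun n =>
    { toFun := fun t => Real.exp (-(q : ℝ) * t) * cutoff n t
      continuous_toFun := by
        have := cutoff_continuous n
        fun_prop
      hasCompactSupport' := (cutoff_supp n).mul_left }
  have hF : ∀ n t, F n t = Real.exp (-(q : ℝ) * t) * cutoff n t := fun n t => rfl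
  have hFnn : ∀ n t, 0 ≤ F n t := fun n t => mul_nonneg (Real.exp_pos _).le (cutoff_nonneg _ _)
  have hup : ∀ n, g (emb (F n)) ≤ G q := by
    intro n
    have := hg1 (E - emb (F n)) (fun t => by
      change 0 ≤ Real.exp (-(q : ℝ) * t) - Real.exp (-(q : ℝ) * t) * cutoff n t
      have h1 := cutoff_le_one n t
      have h2 := Real.exp_pos (-(q : ℝ) * t)
      nlinarith)
    rw [map_sub, hE] at this
    linarith
  have hlow : ∀ n : ℕ, G q - Real.exp (-(δ * n)) * (g Em + g Ep) ≤ g (emb (F n)) := by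
    intro n
    have := hg1 (Real.exp (-(δ * n)) • (Em + Ep) - (E - emb (F n))) (fun t => by
      change 0 ≤ Real.exp (-(δ * n)) * (Real.exp (-((q - δ : ℚ) : ℝ) * t)
        + Real.exp (-((q + δ : ℚ) : ℝ) * t)) - (Real.exp (-(q : ℝ) * t)
          - Real.exp (-(q : ℝ) * t) * cutoff n t)
      by_cases ht : |t| ≤ n
      · rw [cutoff_eq_one ht, mul_one, sub_self, sub_zero]
        positivity
      · push Not at ht
        have h0 := mul_nonneg (Real.exp_pos (-(q : ℝ) * t)).le (cutoff_nonneg n t)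
        have h3 : Real.exp (-(q : ℝ) * t) ≤ Real.exp (-(δ * n)) *
            (Real.exp (-((q - δ : ℚ) : ℝ) * t) + Real.exp (-((q + δ : ℚ) : ℝ) * t)) := by
          rw [mul_add, ← Real.exp_add, ← Real.exp_add]
          rcases lt_abs.mp ht with ht' | ht'
          · refine le_trans ?_ (le_add_of_nonneg_right (Real.exp_pos _).le)
            apply Real.exp_le_exp.mpr
            push_cast
            nlinarith
          · refine le_trans ?_ (le_add_of_nonneg_left (Real.exp_pos _).le)
            apply Real.exp_le_exp.mpr
            push_cast
            nlinarith
        linarith)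
    rw [map_sub, map_smul, map_add, map_sub, hE, smul_eq_mul] at this
    linarith
  have hlim : Tendsto (fun n => g (emb (F n))) atTop (𝓝 (G q)) := by
    refine tendsto_of_tendsto_of_tendsto_of_le_of_le ?_ tendsto_const_nhds hlow hup
    have h1 : Tendsto (fun n : ℕ => Real.exp (-((δ : ℝ) * n))) atTop (𝓝 0) :=
      Real.tendsto_exp_neg_atTop_nhds_zero.comp
        (tendsto_natCast_atTop_atTop.const_mul_atTop hδ0')
    simpa using (h1.mul_const (g Em + g Ep)).const_sub (G q)
  have hGnn : 0 ≤ G q := by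
    rw [← hE]; exact hg1 E fun t => (Real.exp_pos _).le
  have hint : ∀ n, ∫⁻ t, ENNReal.ofReal (F n t) ∂μ = ENNReal.ofReal (g (emb (F n))) := by
    intro n
    have h1 : ∫ t, F n t ∂μ = g (emb (F n)) := RealRMK.integral_rieszMeasure Λ (F n)
    rw [← h1, ofReal_integral_eq_lintegral_ofReal]
    · exact (F n).continuous.integrable_of_hasCompactSupport (F n).hasCompactSupport
    · exact Eventually.of_forall (hFnn n)
  have hmeas : ∀ y : ℝ, Measurable (fun t : ℝ => Real.exp (-y * t)) := by
    intro y; fun_prop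
  have hmono : Tendsto (fun n => ∫⁻ t, ENNReal.ofReal (F n t) ∂μ) atTop
      (𝓝 (∫⁻ t, ENNReal.ofReal (Real.exp (-(q : ℝ) * t)) ∂μ)) := by
    refine lintegral_tendsto_of_tendsto_of_monotone ?_ ?_ ?_
    · intro n
      exact ((F n).continuous.measurable.ennreal_ofReal).aemeasurable
    · refine Eventually.of_forall fun t n m hnm => ?_
      exact ENNReal.ofReal_le_ofReal
        (mul_le_mul_of_nonneg_left (cutoff_mono t hnm) (Real.exp_pos _).le)
    · refine Eventually.of_forall fun t => ?_
      refine tendsto_const_nhds.congr' ?_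
      obtain ⟨n0, hn0⟩ := exists_nat_ge |t|
      filter_upwards [eventually_ge_atTop n0] with n hn
      rw [hF, cutoff_eq_one (hn0.trans (by exact_mod_cast hn)), mul_one]
  simp only [hint] at hmono
  have hval := tendsto_nhds_unique hmono ((ENNReal.continuous_ofReal.tendsto _).comp hlim)
  constructor
  · refine ⟨(hmeas q).aestronglyMeasurable, ?_⟩
    rw [hasFiniteIntegral_iff_ofReal (Eventually.of_forall fun t => (Real.exp_pos _).le), hval]
    exact ENNReal.ofReal_lt_top
  · rw [integral_eq_lintegral_of_nonneg_ae (Eventually.of_forall fun t => (Real.exp_pos _).le)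
      (hmeas q).aestronglyMeasurable, hval, ENNReal.toReal_ofReal hGnn]

/-! ### Laplace transforms -/

lemma exp_le_add {y1 y y2 : ℝ} (h1 : y1 ≤ y) (h2 : y ≤ y2) (t : ℝ) :
    Real.exp (-y * t) ≤ Real.exp (-y1 * t) + Real.exp (-y2 * t) := by
  rcases le_total 0 t with ht | ht
  · refine le_trans ?_ (le_add_of_nonneg_right (Real.exp_pos _).le)
    apply Real.exp_le_exp.mpr
    nlinarith
  · refine le_trans ?_ (le_add_of_nonneg_left (Real.exp_pos _).le)
    apply Real.exp_le_exp.mpr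
    nlinarith

lemma laplace_continuousOn {I : Set ℝ} (hIo : IsOpen I) (μ : Measure ℝ)
    (hμ : ∀ y ∈ I, Integrable (fun t : ℝ => Real.exp (-y * t)) μ) :
    ContinuousOn (fun y => ∫ t : ℝ, Real.exp (-y * t) ∂μ) I := by
  intro y hy
  apply ContinuousAt.continuousWithinAt
  obtain ⟨l, u, hyl, hlu⟩ := mem_nhds_iff_exists_Ioo_subset.mp (hIo.mem_nhds hy)
  obtain ⟨y1, h1, h1'⟩ := exists_between hyl.1
  obtain ⟨y2, h2, h2'⟩ := exists_between hyl.2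
  have hy1 : y1 ∈ I := hlu ⟨h1, h1'.trans hyl.2⟩
  have hy2 : y2 ∈ I := hlu ⟨hyl.1.trans h2, h2'⟩
  refine continuousAt_of_dominated
    (bound := fun t => Real.exp (-y1 * t) + Real.exp (-y2 * t)) ?_ ?_
    ((hμ y1 hy1).add (hμ y2 hy2)) ?_
  · refine Eventually.of_forall fun x => ?_
    have : Measurable (fun t : ℝ => Real.exp (-x * t)) := by fun_prop
    exact this.aestronglyMeasurable
  · filter_upwards [Ioo_mem_nhds h1' h2] with x hx
    refine Eventually.of_forall fun t => ?_
    rw [Real.norm_eq_abs, abs_of_pos (Real.exp_pos _)]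
    exact exp_le_add hx.1.le hx.2.le t
  · refine Eventually.of_forall fun t => ?_
    fun_prop

lemma laplace_coposdef {I : Set ℝ} (G : ℝ → ℝ) (μ : Measure ℝ)
    (hμ : ∀ y ∈ I, Integrable (fun t : ℝ => Real.exp (-y * t)) μ ∧
      G y = ∫ t : ℝ, Real.exp (-y * t) ∂μ) :
    IsCoPosDefOnR (fun x => (G x : ℂ)) I := by
  intro n x hx ξ
  have hterm : ∀ k l, ((G (x k + x l) : ℝ) : ℂ) * ξ k * (starRingEnd ℂ) (ξ l)
      = ∫ t : ℝ, ((Real.exp (-(x k + x l) * t) : ℝ) : ℂ) * ξ k * (starRingEnd ℂ) (ξ l) ∂μ := by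
    intro k l
    rw [(hμ _ (hx k l)).2, ← integral_complex_ofReal, ← integral_mul_const,
      ← integral_mul_const]
  have hi : ∀ k l, Integrable (fun t : ℝ =>
      ((Real.exp (-(x k + x l) * t) : ℝ) : ℂ) * ξ k * (starRingEnd ℂ) (ξ l)) μ := by
    intro k l
    exact (((hμ _ (hx k l)).1.ofReal).mul_const _).mul_const _
  have hsum : ∑ k, ∑ l, ((G (x k + x l) : ℝ) : ℂ) * ξ k * (starRingEnd ℂ) (ξ l)
      = ∫ t : ℝ, ((Complex.normSq (∑ k, ((Real.exp (-(x k) * t) : ℝ) : ℂ) * ξ k) : ℝ) : ℂ) ∂μ := by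
    simp only [hterm]
    have h1 : ∀ k, ∑ l, ∫ t : ℝ,
        ((Real.exp (-(x k + x l) * t) : ℝ) : ℂ) * ξ k * (starRingEnd ℂ) (ξ l) ∂μ
        = ∫ t : ℝ, ∑ l,
        ((Real.exp (-(x k + x l) * t) : ℝ) : ℂ) * ξ k * (starRingEnd ℂ) (ξ l) ∂μ :=
      fun k => (integral_finsetSum _ fun l _ => hi k l).symm
    simp only [h1]
    rw [← integral_finsetSum _ fun k _ => integrable_finsetSum _ fun l _ => hi k l]
    congr 1
    funext t
    rw [← Complex.mul_conj, map_sum, Finset.sum_mul_sum]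
    refine Finset.sum_congr rfl fun k _ => Finset.sum_congr rfl fun l _ => ?_
    rw [map_mul, Complex.conj_ofReal]
    have : Real.exp (-(x k + x l) * t) = Real.exp (-(x k) * t) * Real.exp (-(x l) * t) := by
      rw [← Real.exp_add]; congr 1; ring
    rw [this]
    push_cast
    ring
  rw [hsum, integral_complex_ofReal]
  exact_mod_cast integral_nonneg fun t => Complex.normSq_nonneg _

theorem widder_aux {I : Set ℝ} (hI : I.OrdConnected) (hIo : IsOpen I) (hne : I.Nonempty)
    (G : ℝ → ℝ) : (ContinuousOn G I ∧ IsCoPosDefOnR (fun x => (G x : ℂ)) I) ↔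
    ∃ μ : Measure ℝ, ∀ y ∈ I, Integrable (fun t : ℝ => Real.exp (-y * t)) μ ∧
      G y = ∫ t : ℝ, Real.exp (-y * t) ∂μ := by
  constructor
  · rintro ⟨hcont, hG⟩
    obtain ⟨μ, hμ⟩ := exists_measure_rat hG hI hIo hne
    have hint : ∀ y ∈ I, Integrable (fun t : ℝ => Real.exp (-y * t)) μ := by
      intro y hy
      obtain ⟨l, u, hyl, hlu⟩ := mem_nhds_iff_exists_Ioo_subset.mp (hIo.mem_nhds hy)
      obtain ⟨y1, h1, h1'⟩ := exists_rat_btwn hyl.1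
      obtain ⟨y2, h2, h2'⟩ := exists_rat_btwn hyl.2
      have hy1 : (y1 : ℝ) ∈ I := hlu ⟨h1, h1'.trans hyl.2⟩
      have hy2 : (y2 : ℝ) ∈ I := hlu ⟨hyl.1.trans h2, h2'⟩
      refine ((hμ y1 hy1).1.add (hμ y2 hy2).1).mono' ?_ ?_
      · have : Measurable (fun t : ℝ => Real.exp (-y * t)) := by fun_prop
        exact this.aestronglyMeasurable
      · refine Eventually.of_forall fun t => ?_
        rw [Real.norm_eq_abs, abs_of_pos (Real.exp_pos _)]
        exact exp_le_add h1'.le h2.le t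
    refine ⟨μ, fun y hy => ⟨hint y hy, ?_⟩⟩
    have hL := laplace_continuousOn hIo μ hint
    have hEq : EqOn G (fun y => ∫ t : ℝ, Real.exp (-y * t) ∂μ)
        (I ∩ Set.range ((↑) : ℚ → ℝ)) := by
      rintro _ ⟨hq, q, rfl⟩
      exact (hμ q hq).2
    refine hEq.of_subset_closure hcont hL inter_subset_left ?_ hy
    exact (Rat.denseRange_cast (𝕜 := ℝ)).open_subset_closure_inter hIo
  · rintro ⟨μ, hμ⟩
    refine ⟨?_, laplace_coposdef G μ hμ⟩
    exact (laplace_continuousOn hIo μ fun y hy => (hμ y hy).1).congr fun y hy => (hμ y hy).2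

/-- Widder's theorem: a real-valued function on `(a,b)` is continuous and co-positive definite
iff it is the Laplace transform of a nonnegative Borel measure on `ℝ`. -/
theorem stmt2 (a b : EReal) (hab : a < b) (G : ℝ → ℝ) :
    (ContinuousOn G {y : ℝ | a < (y : EReal) ∧ (y : EReal) < b} ∧
      IsCoPosDefOnR (fun x => (G x : ℂ)) {y : ℝ | a < (y : EReal) ∧ (y : EReal) < b}) ↔
    ∃ μ : Measure ℝ, ∀ y : ℝ, a < (y : EReal) → (y : EReal) < b →
      Integrable (fun t : ℝ => Real.exp (-y * t)) μ ∧
      G y = ∫ t : ℝ, Real.exp (-y * t) ∂μ := by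

  have hI : {y : ℝ | a < (y : EReal) ∧ (y : EReal) < b}.OrdConnected := by
    constructor
    rintro x ⟨hx, _⟩ y ⟨_, hy⟩ z ⟨hz1, hz2⟩
    exact ⟨hx.trans_le (EReal.coe_le_coe_iff.mpr hz1), (EReal.coe_le_coe_iff.mpr hz2).trans_lt hy⟩
  have hIo : IsOpen {y : ℝ | a < (y : EReal) ∧ (y : EReal) < b} :=
    (isOpen_Ioo (a := a) (b := b)).preimage continuous_coe_real_ereal
  have hne : {y : ℝ | a < (y : EReal) ∧ (y : EReal) < b}.Nonempty := by
    obtain ⟨q, h1, h2⟩ := EReal.exists_rat_btwn_of_lt hab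
    exact ⟨(q : ℝ), h1, h2⟩
  rw [widder_aux hI hIo hne G]
  refine exists_congr fun μ => forall_congr' fun y => ?_
  exact and_imp
end
end

section
/- Let a < b be extended reals and let f : S_{a,b} → ℂ. Then f is holomorphic and positive definite on the horizontal strip S_{a,b} if and only if there exists a nonnegative Borel measure μ on ℝ, exponentially finite with respect to the interval (a,b), such that f(z) = ∫ℝ e^{izt} dμ(t) for all z ∈ S_{a,b}. Moreover the measure μ is uniquely determined by f. -/
open Complex MeasureTheory Filter Set Topology
open scoped Real BigOperators ComplexOrder

noncomputable section

/-! ### Basic facts on positive definite functions -/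

lemma posDef_zero_nonneg {g : ℝ → ℂ} (hg : IsPosDefFun g) : 0 ≤ g 0 := by
  simpa using hg 1 (fun _ => 0) (fun _ => 1)

lemma posDef_two {g : ℝ → ℂ} (hg : IsPosDefFun g) (x : ℝ) (ζ : ℂ) :
    0 ≤ g 0 + g x * (starRingEnd ℂ) ζ + (g (-x) * ζ + g 0 * ζ * (starRingEnd ℂ) ζ) := by
  simpa [Fin.sum_univ_two] using hg 2 ![x, 0] ![1, ζ]

lemma posDef_neg {g : ℝ → ℂ} (hg : IsPosDefFun g) (x : ℝ) :
    g (-x) = (starRingEnd ℂ) (g x) := by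
  have h0 := (Complex.le_def.1 (posDef_zero_nonneg hg)).2
  have h1 := (Complex.le_def.1 (posDef_two hg x 1)).2
  have h2 := (Complex.le_def.1 (posDef_two hg x I)).2
  simp at h0 h1 h2
  apply Complex.ext <;> simp <;> linarith

lemma posDef_norm_le {g : ℝ → ℂ} (hg : IsPosDefFun g) (x : ℝ) : ‖g x‖ ≤ (g 0).re := by
  by_cases hx : g x = 0
  · have h0 := (Complex.le_def.1 (posDef_zero_nonneg hg)).1
    simpa [hx] using h0
  · have hn : (‖g x‖ : ℂ) ≠ 0 := by simpa using hx
    have h := posDef_two hg x (-(g x / ‖g x‖))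
    have e : g x * (starRingEnd ℂ) (g x) = (‖g x‖ : ℂ) ^ 2 := Complex.mul_conj' _
    have e1 : g x * (starRingEnd ℂ) (-(g x / ‖g x‖)) = -(‖g x‖ : ℂ) := by
      rw [map_neg, map_div₀, Complex.conj_ofReal]
      field_simp
      rw [e]
    have e2 : g (-x) * (-(g x / ‖g x‖)) = -(‖g x‖ : ℂ) := by
      rw [posDef_neg hg]
      field_simp
      rw [mul_comm, e]
    have e3 : g 0 * (-(g x / ‖g x‖)) * (starRingEnd ℂ) (-(g x / ‖g x‖)) = g 0 := by
      rw [map_neg, map_div₀, Complex.conj_ofReal]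
      have : g 0 * (-(g x / ‖g x‖)) * (-((starRingEnd ℂ) (g x) / ‖g x‖))
        = g 0 * (g x * (starRingEnd ℂ) (g x)) / (‖g x‖ : ℂ) ^ 2 := by field_simp
      rw [this, e]
      field_simp
    rw [e1, e2, e3] at h
    have := (Complex.le_def.1 h).1
    simp at this
    linarith

lemma posDef_mul_exp {g : ℝ → ℂ} (hg : IsPosDefFun g) (t : ℝ) :
    IsPosDefFun (fun x => g x * Complex.exp (((t * x : ℝ) : ℂ) * I)) := by
  intro n x ξ
  have h := hg n x (fun k => ξ k * Complex.exp (((t * x k : ℝ) : ℂ) * I))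
  refine h.trans_eq (Finset.sum_congr rfl fun k _ => Finset.sum_congr rfl fun l _ => ?_)
  rw [map_mul, ← Complex.exp_conj, map_mul, Complex.conj_ofReal, Complex.conj_I]
  have : Complex.exp (((t * (x k - x l) : ℝ) : ℂ) * I) =
      Complex.exp (((t * x k : ℝ) : ℂ) * I) * Complex.exp (((t * x l : ℝ) : ℂ) * -I) := by
    rw [← Complex.exp_add]; congr 1; push_cast; ring
  dsimp only
  rw [this]; ring

lemma posDef_comp_mul {g : ℝ → ℂ} (hg : IsPosDefFun g) (c : ℝ) :
    IsPosDefFun (fun x => g (c * x)) := by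
  intro n x ξ
  simpa [mul_sub] using hg n (fun k => c * x k) ξ

open ProbabilityTheory in
/-- The expectation of a continuous positive definite function under a centred Gaussian is
nonnegative. -/
lemma posDef_integral_gaussian {g : ℝ → ℂ} (hg : IsPosDefFun g) (hc : Continuous g)
    (v : NNReal) : 0 ≤ ∫ x, g x ∂(gaussianReal 0 (v + v)) := by
  set J := ∫ x, g x ∂(gaussianReal 0 (v + v)) with hJ
  have key : ∀ n : ℕ, 0 ≤ (n : ℂ) * g 0 + ((n : ℂ) * n - n) * J := by
    intro n
    set P : Measure (Fin n → ℝ) := Measure.pi (fun _ => gaussianReal 0 v) with hP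
    have hind : iIndepFun (fun (i : Fin n) (ω : Fin n → ℝ) => ω i) P :=
      iIndepFun_pi (μ := fun _ : Fin n => gaussianReal 0 v) (X := fun _ x => x)
        (fun i => aemeasurable_id)
    have hmap : ∀ k : Fin n, P.map (fun ω => ω k) = gaussianReal 0 v := fun k =>
      (measurePreserving_eval (fun _ : Fin n => gaussianReal 0 v) k).map_eq
    have hmapneg : ∀ k : Fin n, P.map (fun ω => -ω k) = gaussianReal 0 v := by
      intro k
      have : (fun ω : Fin n → ℝ => -ω k) = (fun x => -x) ∘ (fun ω => ω k) := rfl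
      rw [this, ← Measure.map_map (by fun_prop) (by fun_prop), hmap, gaussianReal_map_neg, neg_zero]
    have hmapsub : ∀ k l : Fin n, k ≠ l → P.map (fun ω => ω k - ω l) = gaussianReal 0 (v + v) := by
      intro k l hkl
      have h1 := (hind.indepFun hkl).comp measurable_id (measurable_neg (G := ℝ))
      have h2 := gaussianReal_add_gaussianReal_of_indepFun h1 (hmap k) (hmapneg l)
      rw [add_zero] at h2
      rw [← h2]
      congr 1
    have hval : ∀ k l : Fin n, ∫ ω, g (ω k - ω l) ∂P = if k = l then g 0 else J := by
      intro k l
      split_ifs with h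
      · subst h; simp
      · rw [hJ, ← hmapsub k l h, integral_map (by fun_prop) (hc.aestronglyMeasurable)]
    have hInt : ∀ k l : Fin n, Integrable (fun ω : Fin n → ℝ => g (ω k - ω l)) P := by
      intro k l
      refine Integrable.of_bound (C := (g 0).re) (by
        apply Continuous.aestronglyMeasurable; fun_prop) ?_
      exact ae_of_all _ fun ω => posDef_norm_le hg _
    have h1 : 0 ≤ ∫ ω, ∑ k, ∑ l, g (ω k - ω l) ∂P := by
      refine integral_nonneg fun ω => ?_
      simpa using hg n ω (fun _ => 1)
    rw [integral_finsetSum _ (fun k _ => integrable_finsetSum _ fun l _ => hInt k l)] at h1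
    simp_rw [integral_finsetSum _ (fun l _ => hInt _ l), hval] at h1
    refine h1.trans_eq ?_
    have : ∀ k l : Fin n, (if k = l then g 0 else J) = J + if k = l then g 0 - J else 0 := by
      intro k l; split_ifs <;> ring
    simp_rw [this, Finset.sum_add_distrib]
    simp
    ring
  have hn : ∀ n : ℕ, 0 ≤ (g 0) * ((1 : ℝ) / ((n : ℝ) + 1) : ℝ) + J := by
    intro n
    have h := key (n + 2)
    have h2 : (0 : ℂ) ≤ (((1 : ℝ) / (((n : ℝ) + 2) * ((n : ℝ) + 1)) : ℝ) : ℂ) := by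
      rw [Complex.zero_le_real]; positivity
    refine (mul_nonneg h2 h).trans_eq ?_
    have a1 : ((n : ℂ) + 1) ≠ 0 := by exact_mod_cast Nat.succ_ne_zero n
    have a2 : ((n : ℂ) + 2) ≠ 0 := by exact_mod_cast (Nat.succ_ne_zero (n+1))
    push_cast
    field_simp
    ring
  have hlim : Tendsto (fun n : ℕ => (g 0) * ((1 : ℝ) / ((n : ℝ) + 1) : ℝ) + J) atTop
      (𝓝 (g 0 * ((0 : ℝ) : ℂ) + J)) :=
    ((Complex.continuous_ofReal.tendsto _).comp
      tendsto_one_div_add_atTop_nhds_zero_nat).const_mul _ |>.add_const _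
  have := ge_of_tendsto' hlim hn
  simpa using this

/-! ### Bochner's theorem -/

open scoped FourierTransform in
/-- A continuous integrable bounded function whose Fourier transform is nonnegative has an
integrable Fourier transform. -/
lemma integrable_fourier_of_nonneg {ψ : ℝ → ℂ} {M : ℝ} (hi : Integrable ψ)
    (hM : ∀ x, ‖ψ x‖ ≤ M) (hpos : ∀ w, 0 ≤ 𝓕 ψ w) : Integrable (𝓕 ψ) := by
  have hcont : Continuous (𝓕 ψ) :=
    VectorFourier.fourierIntegral_continuous Real.continuous_fourierChar
      (by fun_prop) hi
  have hnorm : ∀ w, 𝓕 ψ w = ((‖𝓕 ψ w‖ : ℝ) : ℂ) := fun w => (Complex.norm_of_nonneg' (hpos w)).symm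
  refine ⟨hcont.aestronglyMeasurable, ?_⟩
  have hM0 : 0 ≤ M := (norm_nonneg _).trans (hM 0)
  -- Gaussian damping
  have hb : ∀ δ : ℝ, 0 < δ →
      ∫⁻ w, ENNReal.ofReal (‖𝓕 ψ w‖ * Real.exp (-Real.pi * δ * w ^ 2)) ≤ ENNReal.ofReal M := by
    intro δ hδ
    have hδ' : 0 < (δ : ℂ).re := by simpa using hδ
    have hgi : Integrable (fun w : ℝ => Complex.exp (-(Real.pi : ℂ) * δ * (w : ℂ) ^ 2)) := by
      have := integrable_cexp_neg_mul_sq (b := (Real.pi : ℂ) * δ)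
        (by rw [← Complex.ofReal_mul, Complex.ofReal_re]; positivity)
      simpa [neg_mul] using this
    have hflip : ∫ w : ℝ, 𝓕 ψ w • Complex.exp (-(Real.pi : ℂ) * δ * (w : ℂ) ^ 2) =
        ∫ x : ℝ, ψ x • 𝓕 (fun w : ℝ => Complex.exp (-(Real.pi : ℂ) * δ * (w : ℂ) ^ 2)) x := by
      have h := VectorFourier.integral_fourierIntegral_smul_eq_flip (L := innerₗ ℝ)
        (μ := volume) (ν := volume) Real.continuous_fourierChar (by fun_prop) hi hgi
      rw [flip_innerₗ] at h
      exact h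
    rw [fourier_gaussian_pi hδ'] at hflip
    have hE : Integrable (fun x : ℝ => Real.exp (-(Real.pi / δ) * x ^ 2)) :=
      integrable_exp_neg_mul_sq (by positivity)
    have hnc : ∀ x : ℝ, ‖(1 / (δ : ℂ) ^ (1 / 2 : ℂ) * Complex.exp (-(Real.pi : ℂ) / δ * (x : ℂ) ^ 2))‖
        = (Real.sqrt δ)⁻¹ * Real.exp (-(Real.pi / δ) * x ^ 2) := by
      intro x
      rw [norm_mul, Complex.norm_exp, norm_div, Complex.norm_cpow_eq_rpow_re_of_pos hδ]
      have : (-(Real.pi : ℂ) / δ * (x : ℂ) ^ 2).re = -(Real.pi / δ) * x ^ 2 := by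
        rw [show (-(Real.pi : ℂ) / δ * (x : ℂ) ^ 2) = ((-(Real.pi / δ) * x ^ 2 : ℝ) : ℂ) by
          push_cast; ring, Complex.ofReal_re]
      rw [this, Real.sqrt_eq_rpow]
      simp
    have hle : ‖∫ x : ℝ, ψ x • (1 / (δ : ℂ) ^ (1 / 2 : ℂ) *
        Complex.exp (-(Real.pi : ℂ) / δ * (x : ℂ) ^ 2))‖ ≤ M := by
      calc _ ≤ ∫ x : ℝ, M * ((Real.sqrt δ)⁻¹ * Real.exp (-(Real.pi / δ) * x ^ 2)) := by
            refine norm_integral_le_of_norm_le ((hE.const_mul _).const_mul _) (ae_of_all _ fun x => ?_)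
            rw [norm_smul, hnc]
            gcongr
            exact hM x
        _ = M := by
            rw [integral_const_mul, integral_const_mul, integral_gaussian]
            have : Real.pi / (Real.pi / δ) = δ := by field_simp
            rw [this]
            have : Real.sqrt δ ≠ 0 := (Real.sqrt_pos.2 hδ).ne'
            field_simp
    rw [← hflip] at hle
    have hre : ∀ w : ℝ, 𝓕 ψ w • Complex.exp (-(Real.pi : ℂ) * δ * (w : ℂ) ^ 2) =
        ((‖𝓕 ψ w‖ * Real.exp (-Real.pi * δ * w ^ 2) : ℝ) : ℂ) := by
      intro w
      rw [hnorm w]; simp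
    simp_rw [hre] at hle
    rw [integral_complex_ofReal, Complex.norm_real, Real.norm_eq_abs] at hle
    have hi2 : Integrable (fun w : ℝ => ‖𝓕 ψ w‖ * Real.exp (-Real.pi * δ * w ^ 2)) := by
      have hE2 : Integrable (fun x : ℝ => Real.exp (-(Real.pi * δ) * x ^ 2)) :=
        integrable_exp_neg_mul_sq (by positivity)
      refine Integrable.mono' (hE2.const_mul (∫ x, ‖ψ x‖)) (by
        apply Continuous.aestronglyMeasurable; fun_prop) (ae_of_all _ fun w => ?_)
      rw [norm_mul, norm_norm, Real.norm_eq_abs, abs_of_pos (Real.exp_pos _), neg_mul]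
      gcongr
      exact VectorFourier.norm_fourierIntegral_le_integral_norm _ _ _ _ _
    rw [← ofReal_integral_eq_lintegral_ofReal hi2 (ae_of_all _ fun w => by positivity)]
    exact ENNReal.ofReal_le_ofReal ((le_abs_self _).trans hle)
  have hF := lintegral_liminf_le (μ := (volume : Measure ℝ)) (u := atTop)
    (f := fun (n : ℕ) w => ENNReal.ofReal (‖𝓕 ψ w‖ * Real.exp (-Real.pi * (1 / ((n : ℝ) + 1)) * w ^ 2)))
    (fun n => (by fun_prop : Continuous fun w => ‖𝓕 ψ w‖ *
      Real.exp (-Real.pi * (1 / ((n : ℝ) + 1)) * w ^ 2)).measurable.ennreal_ofReal)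
  have hl : ∀ w, liminf (fun n : ℕ => ENNReal.ofReal (‖𝓕 ψ w‖ *
      Real.exp (-Real.pi * (1 / ((n : ℝ) + 1)) * w ^ 2))) atTop = ENNReal.ofReal ‖𝓕 ψ w‖ := by
    intro w
    apply Tendsto.liminf_eq
    have h0 : Tendsto (fun n : ℕ => -Real.pi * (1 / ((n : ℝ) + 1)) * w ^ 2) atTop
        (𝓝 (-Real.pi * 0 * w ^ 2)) :=
      (tendsto_one_div_add_atTop_nhds_zero_nat.const_mul _).mul_const _
    have h1 := ((Real.continuous_exp.tendsto _).comp h0).const_mul ‖𝓕 ψ w‖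
    have h2 := (ENNReal.continuous_ofReal.tendsto _).comp h1
    simpa [Function.comp_def] using h2
  simp_rw [hl] at hF
  have hle2 : liminf (fun n : ℕ => ∫⁻ w, ENNReal.ofReal (‖𝓕 ψ w‖ *
      Real.exp (-Real.pi * (1 / ((n : ℝ) + 1)) * w ^ 2))) atTop ≤ ENNReal.ofReal M := by
    refine liminf_le_of_frequently_le' (Frequently.of_forall fun n => hb _ (by positivity))
  rw [HasFiniteIntegral]
  simp_rw [← ofReal_norm]
  exact (hF.trans hle2).trans_lt ENNReal.ofReal_lt_top

open scoped FourierTransform in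
lemma bochner_reg {g : ℝ → ℂ} (hg : IsPosDefFun g) (hc : Continuous g) {v : NNReal} (hv : v ≠ 0) :
    ∃ μ : Measure ℝ, IsFiniteMeasure μ ∧ ∀ x : ℝ,
      ∫ w : ℝ, Complex.exp (((2 * Real.pi * (x * w) : ℝ) : ℂ) * I) ∂μ =
        g x * (Real.exp (-x ^ 2 / (2 * ((v + v : NNReal) : ℝ))) : ℝ) := by
  have hV : (v + v) ≠ 0 := by simpa using hv
  have hV' : (0 : ℝ) < ((v + v : NNReal) : ℝ) := by
    exact_mod_cast pos_iff_ne_zero.2 hV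
  set V := v + v with hVdef
  set ψ : ℝ → ℂ := fun x => g x * (Real.exp (-x ^ 2 / (2 * (V : ℝ))) : ℝ) with hψ
  have hψc : Continuous ψ := by fun_prop
  have hE : Integrable (fun x : ℝ => Real.exp (-x ^ 2 / (2 * (V : ℝ)))) := by
    have := integrable_exp_neg_mul_sq (b := 1 / (2 * (V : ℝ))) (by positivity)
    refine this.congr (ae_of_all _ fun x => ?_)
    simp only []
    congr 1; ring
  have hψi : Integrable ψ := by
    refine Integrable.mono' (hE.const_mul (g 0).re) hψc.aestronglyMeasurable (ae_of_all _ fun x => ?_)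
    rw [hψ, norm_mul, Complex.norm_real, Real.norm_eq_abs, abs_of_pos (Real.exp_pos _)]
    gcongr
    exact posDef_norm_le hg x
  have hψM : ∀ x, ‖ψ x‖ ≤ (g 0).re := by
    intro x
    have h0 : 0 ≤ (g 0).re := (Complex.le_def.1 (posDef_zero_nonneg hg)).1
    rw [hψ, norm_mul, Complex.norm_real, Real.norm_eq_abs, abs_of_pos (Real.exp_pos _)]
    have h1 : Real.exp (-x ^ 2 / (2 * (V : ℝ))) ≤ 1 := by
      rw [Real.exp_le_one_iff]
      apply div_nonpos_of_nonpos_of_nonneg (by nlinarith [sq_nonneg x]) (by positivity)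
    calc _ ≤ (g 0).re * 1 := mul_le_mul (posDef_norm_le hg x) h1 (Real.exp_pos _).le h0
      _ = _ := mul_one _
  have hpos : ∀ w, 0 ≤ 𝓕 ψ w := by
    intro w
    have h := posDef_integral_gaussian (posDef_mul_exp hg (-2 * Real.pi * w)) (by fun_prop) v
    rw [← hVdef, ProbabilityTheory.integral_gaussianReal_eq_integral_smul hV] at h
    rw [Real.fourier_eq']
    set A : ℝ := (√(2 * Real.pi * V)) with hA
    have hApos : 0 < A := Real.sqrt_pos.2 (by positivity)
    have hA0 : (0 : ℂ) ≤ (A : ℂ) := by rw [Complex.zero_le_real]; exact hApos.le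
    refine (mul_nonneg hA0 h).trans_eq ?_
    rw [← integral_const_mul]
    congr 1
    ext x
    have hAc : (A : ℂ) ≠ 0 := by exact_mod_cast hApos.ne'
    rw [ProbabilityTheory.gaussianPDFReal, hψ, ← hA]
    simp only [sub_zero, Complex.real_smul, smul_eq_mul]
    have : (inner ℝ x w : ℝ) = w * x := by simp
    rw [this, ← mul_assoc (-2 * Real.pi) w x]
    push_cast
    field_simp
  have hFi := integrable_fourier_of_nonneg hψi hψM hpos
  have hinv := hψc.fourierInv_fourier_eq hψi hFi
  have hcont : Continuous (𝓕 ψ) :=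
    VectorFourier.fourierIntegral_continuous Real.continuous_fourierChar
      (by fun_prop) hψi
  refine ⟨volume.withDensity (fun w => ENNReal.ofReal ‖𝓕 ψ w‖), ?_, ?_⟩
  · exact isFiniteMeasure_withDensity_ofReal hFi.norm.2
  · intro x
    rw [integral_withDensity_eq_integral_toReal_smul
      (hcont.norm.measurable.ennreal_ofReal) (ae_of_all _ fun w => ENNReal.ofReal_lt_top)]
    have := congrFun hinv x
    rw [Real.fourierInv_eq'] at this
    rw [← show ψ x = g x * (Real.exp (-x ^ 2 / (2 * (V : ℝ))) : ℝ) from rfl, ← this]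
    congr 1
    ext w
    rw [ENNReal.toReal_ofReal (norm_nonneg _), Complex.real_smul,
      Complex.norm_of_nonneg' (hpos w), smul_eq_mul, mul_comm]
    congr 4

lemma bochner_prob {g : ℝ → ℂ} (hg : IsPosDefFun g) (hc : Continuous g) (h1 : g 0 = 1) :
    ∃ μ : Measure ℝ, IsFiniteMeasure μ ∧ ∀ x : ℝ, charFun μ x = g x := by
  have H : ∀ n : ℕ, ∃ μ : Measure ℝ, IsFiniteMeasure μ ∧ ∀ x : ℝ, charFun μ x =
      g x * (Real.exp (-(x / (2 * Real.pi)) ^ 2 / (2 * (((n : ℝ) + 1) + (n + 1)))) : ℝ) := by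
    intro n
    obtain ⟨μ, hμ, h⟩ := bochner_reg (posDef_comp_mul hg (2 * Real.pi)) (by fun_prop)
      (v := (n : NNReal) + 1) (by positivity)
    refine ⟨μ, hμ, fun x => ?_⟩
    have h2 := h (x / (2 * Real.pi))
    have e1 : 2 * Real.pi * (x / (2 * Real.pi)) = x := by field_simp
    rw [e1] at h2
    push_cast at h2 ⊢
    rw [← h2, charFun_apply_real]
    congr 1
    ext w
    congr 2
    have : (Real.pi : ℂ) ≠ 0 := by exact_mod_cast Real.pi_ne_zero
    field_simp
  choose μ hμ hch using H
  have hprob : ∀ n, IsProbabilityMeasure (μ n) := by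
    intro n
    have h := hch n 0
    rw [charFun_zero, h1] at h
    simp at h
    constructor
    have h3 : (μ n).real univ = 1 := by exact_mod_cast h
    rw [measureReal_def] at h3
    rw [← ENNReal.ofReal_toReal (measure_ne_top (μ n) univ), h3, ENNReal.ofReal_one]
  have hlim : ∀ t, Tendsto (fun n ↦ charFun (μ n) t) atTop (𝓝 (g t)) := by
    intro t
    simp_rw [hch]
    have h0 : Tendsto (fun n : ℕ => (-(t / (2 * Real.pi)) ^ 2 / 4) * (1 / ((n : ℝ) + 1))) atTop
        (𝓝 ((-(t / (2 * Real.pi)) ^ 2 / 4) * 0)) :=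
      tendsto_one_div_add_atTop_nhds_zero_nat.const_mul _
    have h2 := ((Complex.continuous_ofReal.comp Real.continuous_exp).tendsto _).comp h0
    have h3 := h2.const_mul (g t)
    simp only [mul_zero, Function.comp_def, Real.exp_zero, Complex.ofReal_one, mul_one] at h3
    refine h3.congr fun n => ?_
    congr 3
    have : (n : ℝ) + 1 ≠ 0 := by positivity
    field_simp
    ring
  have htight := isTightMeasureSet_of_tendsto_charFun (hc.continuousAt) hlim
  let P : ℕ → ProbabilityMeasure ℝ := fun n => ⟨μ n, hprob n⟩
  have hK : IsCompact (closure (range P)) := by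
    apply isCompact_closure_of_isTightMeasureSet
    convert! htight using 1
    ext m
    constructor
    · rintro ⟨_, ⟨n, rfl⟩, rfl⟩
      exact ⟨n, rfl⟩
    · rintro ⟨n, rfl⟩
      exact ⟨P n, ⟨n, rfl⟩, rfl⟩
  let U : Ultrafilter ℕ := Ultrafilter.of atTop
  have hU : (U : Filter ℕ) ≤ atTop := Ultrafilter.of_le _
  obtain ⟨μ', -, hμ' : Tendsto P U (𝓝 μ')⟩ := hK.ultrafilter_le_nhds (U.map P)
    (by
      rw [le_principal_iff]
      exact Filter.mem_of_superset (Filter.range_mem_map) subset_closure)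
  refine ⟨μ', inferInstance, fun x => ?_⟩
  rw [ProbabilityMeasure.tendsto_iff_forall_integral_rclike_tendsto ℂ] at hμ'
  have h := hμ' (BoundedContinuousFunction.innerProbChar x)
  have h2 : Tendsto (fun n => charFun (μ n) x) U (𝓝 (charFun (μ' : Measure ℝ) x)) := by
    simp_rw [charFun_eq_integral_innerProbChar]
    exact h
  exact tendsto_nhds_unique h2 ((hlim x).mono_left hU)

/-- **Bochner's theorem** on the real line. -/
lemma bochner {g : ℝ → ℂ} (hg : IsPosDefFun g) (hc : Continuous g) :
    ∃ μ : Measure ℝ, IsFiniteMeasure μ ∧ ∀ x : ℝ, charFun μ x = g x := by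
  have hr := Complex.le_def.1 (posDef_zero_nonneg hg)
  have h0 : g 0 = (((g 0).re : ℝ) : ℂ) := Complex.ext (by simp) (by simpa using hr.2.symm)
  rcases eq_or_lt_of_le hr.1 with h | h
  · refine ⟨0, inferInstance, fun x => ?_⟩
    have := posDef_norm_le hg x
    simp only [Complex.zero_re] at h
    rw [← h] at this
    simp [norm_le_zero_iff.1 this]
  · simp only [Complex.zero_re] at h
    set A := (g 0).re with hA
    have hAc : (A : ℂ) ≠ 0 := by exact_mod_cast h.ne'
    have hpd : IsPosDefFun (fun x => ((A⁻¹ : ℝ) : ℂ) * g x) := by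
      intro n x ξ
      have h1 : (0 : ℂ) ≤ ((A⁻¹ : ℝ) : ℂ) := by rw [Complex.zero_le_real]; positivity
      refine (mul_nonneg h1 (hg n x ξ)).trans_eq ?_
      simp_rw [Finset.mul_sum, mul_assoc]
    obtain ⟨μ, hμ, hch⟩ := bochner_prob hpd (by fun_prop) (by rw [h0]; push_cast; field_simp)
    refine ⟨(A.toNNReal) • μ, inferInstance, fun x => ?_⟩
    have : charFun (A.toNNReal • μ) x = (A : ℂ) * charFun μ x := by
      rw [charFun_apply_real, charFun_apply_real, integral_smul_nnreal_measure]
      rw [NNReal.smul_def, Real.coe_toNNReal _ h.le, Complex.real_smul]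
    rw [this, hch]
    push_cast
    field_simp

/-! ### Shifting the line of integration -/

lemma contour_shift {F : ℂ → ℂ} {c c' B : ℝ}
    (hd : DifferentiableOn ℂ F {z | z.im ∈ uIcc c c'})
    (hB : ∀ z : ℂ, z.im ∈ uIcc c c' → ‖F z‖ ≤ B * Real.exp (-(1 / 2) * z.re ^ 2)) :
    ∫ x : ℝ, F (x + c * I) = ∫ x : ℝ, F (x + c' * I) := by
  have hB0 : 0 ≤ B := by
    have := (norm_nonneg _).trans (hB (c * I) (by simp))
    simpa using this
  have hInt : ∀ y ∈ uIcc c c', Integrable (fun x : ℝ => F (x + y * I)) := by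
    intro y hy
    have hcont : Continuous (fun x : ℝ => F (x + y * I)) := by
      have h1 : Continuous (fun x : ℝ => (x : ℂ) + y * I) := by fun_prop
      exact hd.continuousOn.comp_continuous h1 (fun x => by simpa using hy)
    refine Integrable.mono' ((integrable_exp_neg_mul_sq (b := 1 / 2) (by norm_num)).const_mul B)
      hcont.aestronglyMeasurable (ae_of_all _ fun x => ?_)
    simpa using hB (x + y * I) (by simpa using hy)
  have hvert : ∀ s : ℝ → ℝ, (∀ T, (s T) ^ 2 = T ^ 2) →
      Tendsto (fun T : ℝ => ∫ y : ℝ in c..c', F ((s T : ℝ) + y * I)) atTop (𝓝 0) := by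
    intro s hs
    rw [tendsto_zero_iff_norm_tendsto_zero]
    have hlim : Tendsto (fun T : ℝ => B * Real.exp (-(1 / 2) * T ^ 2) * |c' - c|) atTop
        (𝓝 (B * 0 * |c' - c|)) := by
      refine Tendsto.mul_const _ (Tendsto.const_mul _ (Real.tendsto_exp_atBot.comp ?_))
      exact (tendsto_pow_atTop (by norm_num)).const_mul_atTop_of_neg (by norm_num)
    simp only [mul_zero, zero_mul] at hlim
    refine squeeze_zero (fun _ => norm_nonneg _) (fun T => ?_) hlim
    refine intervalIntegral.norm_integral_le_of_norm_le_const fun y hy => ?_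
    have := hB ((s T : ℝ) + y * I) (by simpa using uIoc_subset_uIcc hy)
    simpa [hs] using this
  have hl1 := intervalIntegral_tendsto_integral (hInt c left_mem_uIcc)
    tendsto_neg_atTop_atBot tendsto_id
  have hl2 := intervalIntegral_tendsto_integral (hInt c' right_mem_uIcc)
    tendsto_neg_atTop_atBot tendsto_id
  have hv1 := (hvert (fun T => T) (fun T => rfl)).const_mul I
  have hv2 := (hvert (fun T => -T) (fun T => by ring)).const_mul I
  have hsum := ((hl1.sub hl2).add hv1).sub hv2
  have hzero : ∀ T : ℝ, (((∫ x in -T..id T, F (x + c * I)) - ∫ x in -T..id T, F (x + c' * I)) +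
      I * ∫ y in c..c', F ((T : ℝ) + y * I)) - I * ∫ y in c..c', F (((-T : ℝ) : ℂ) + y * I) = 0 := by
    intro T
    have := integral_boundary_rect_eq_zero_of_differentiableOn F ((-T : ℝ) + c * I) ((T : ℝ) + c' * I)
      (hd.mono (by
        intro z hz
        rw [mem_reProdIm] at hz
        simpa using hz.2))
    simpa using this
  simp only [hzero] at hsum
  have := tendsto_nhds_unique hsum tendsto_const_nhds
  simp only [mul_zero, add_zero, sub_zero] at this
  exact sub_eq_zero.1 this

/-! ### The strip -/

lemma isOpen_HStrip (a b : EReal) : IsOpen (HStrip a b) := by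
  have h : Continuous (fun z : ℂ => ((z.im : ℝ) : EReal)) :=
    continuous_coe_real_ereal.comp Complex.continuous_im
  exact (isOpen_lt continuous_const h).inter (isOpen_lt h continuous_const)

lemma posDef_line {a b : EReal} {f : ℂ → ℂ} (hpd : IsPosDefOnC f (HStrip a b)) {c : ℝ}
    (hac : a < c) (hcb : c < b) : IsPosDefFun (fun x : ℝ => f (x + c * I)) := by
  intro n x ξ
  have e : ∀ k l, ((x k : ℂ) + ((c / 2 : ℝ) : ℂ) * I) -
      (starRingEnd ℂ) ((x l : ℂ) + ((c / 2 : ℝ) : ℂ) * I) = ((x k - x l : ℝ) : ℂ) + c * I := by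
    intro k l
    rw [map_add, map_mul, Complex.conj_ofReal, Complex.conj_ofReal, Complex.conj_I]
    push_cast; ring
  have h := hpd n (fun k => (x k : ℂ) + ((c / 2 : ℝ) : ℂ) * I) (fun k l => by
    rw [e]
    simp [HStrip, hac, hcb]) ξ
  simp_rw [e] at h
  exact h

lemma continuous_line {a b : EReal} {f : ℂ → ℂ} (hd : DifferentiableOn ℂ f (HStrip a b)) {c : ℝ}
    (hac : a < c) (hcb : c < b) : Continuous (fun x : ℝ => f (x + c * I)) := by
  have h1 : Continuous (fun x : ℝ => (x : ℂ) + c * I) := by fun_prop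
  exact hd.continuousOn.comp_continuous h1 (fun x => by simp [HStrip, hac, hcb])

lemma uIcc_strip {a b : EReal} {c c' : ℝ} (hac : a < c) (hcb : c < b) (hac' : a < c')
    (hcb' : c' < b) {y : ℝ} (hy : y ∈ uIcc c c') : a < (y : EReal) ∧ (y : EReal) < b := by
  rw [mem_uIcc] at hy
  rcases hy with ⟨h1, h2⟩ | ⟨h1, h2⟩
  · exact ⟨hac.trans_le (EReal.coe_le_coe_iff.2 h1), (EReal.coe_le_coe_iff.2 h2).trans_lt hcb'⟩
  · exact ⟨hac'.trans_le (EReal.coe_le_coe_iff.2 h1), (EReal.coe_le_coe_iff.2 h2).trans_lt hcb⟩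

/-- The Gaussian-smoothed integral along a horizontal line does not depend on the line. -/
lemma shift_strip {a b : EReal} {f : ℂ → ℂ} (hd : DifferentiableOn ℂ f (HStrip a b))
    (hpd : IsPosDefOnC f (HStrip a b)) {c c' : ℝ} (hac : a < c) (hcb : c < b) (hac' : a < c')
    (hcb' : c' < b) (u : ℝ) :
    ∫ x : ℝ, Complex.exp (-(1 / 2) * ((x : ℂ) + c * I) ^ 2) * f ((x : ℂ) + c * I + u) =
      ∫ x : ℝ, Complex.exp (-(1 / 2) * ((x : ℂ) + c' * I) ^ 2) * f ((x : ℂ) + c' * I + u) := by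
  have hmem : ∀ z : ℂ, z.im ∈ uIcc c c' → z ∈ HStrip a b := fun z hz =>
    uIcc_strip hac hcb hac' hcb' hz
  obtain ⟨C, hC⟩ : ∃ C, ∀ y ∈ uIcc c c', ‖f (y * I)‖ * Real.exp (y ^ 2 / 2) ≤ C := by
    have hcont : ContinuousOn (fun y : ℝ => ‖f (y * I)‖ * Real.exp (y ^ 2 / 2)) (uIcc c c') := by
      refine ContinuousOn.mul (ContinuousOn.norm ?_) (by fun_prop)
      refine hd.continuousOn.comp (t := HStrip a b) (by fun_prop) (fun y hy => ?_)
      exact hmem _ (by simpa using hy)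
    obtain ⟨C, hC⟩ := isCompact_uIcc.exists_bound_of_continuousOn hcont
    exact ⟨C, fun y hy => (le_abs_self _).trans (hC y hy)⟩
  refine contour_shift (F := fun z => Complex.exp (-(1 / 2) * z ^ 2) * f (z + u)) (B := C) ?_ ?_
  · refine DifferentiableOn.mul (by fun_prop) (hd.comp (by fun_prop) fun z hz => ?_)
    exact hmem _ (by simpa using hz)
  · intro z hz
    have hs := hmem z hz
    have h1 : ‖f (z + u)‖ ≤ ‖f (z.im * I)‖ := by
      have h := posDef_norm_le (posDef_line hpd hs.1 hs.2) (z.re + u)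
      have e : (((z.re + u : ℝ) : ℂ) + z.im * I) = z + u := by
        conv_rhs => rw [← Complex.re_add_im z]
        push_cast; ring
      rw [e] at h
      refine h.trans ((Complex.re_le_norm _).trans_eq ?_)
      simp
    have h2 : (-(1 / 2) * z ^ 2 : ℂ).re = z.im ^ 2 / 2 + (-(1 / 2) * z.re ^ 2) := by
      have : (-(1 / 2) * z ^ 2 : ℂ) = ((-(1 / 2) : ℝ) : ℂ) * (z ^ 2) := by push_cast; ring
      rw [this, Complex.re_ofReal_mul, sq z, Complex.mul_re]; ring
    rw [norm_mul, Complex.norm_exp, h2, Real.exp_add]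
    calc _ ≤ Real.exp (z.im ^ 2 / 2) * Real.exp (-(1 / 2) * z.re ^ 2) * ‖f (z.im * I)‖ := by gcongr
      _ = (‖f (z.im * I)‖ * Real.exp (z.im ^ 2 / 2)) * Real.exp (-(1 / 2) * z.re ^ 2) := by ring
      _ ≤ _ := by gcongr; exact hC _ hz

/-- The smoothed integral in terms of the measure representing `f` on a line. -/
lemma smooth_line {f : ℂ → ℂ} {c : ℝ} {ν : Measure ℝ} [IsFiniteMeasure ν]
    (hν : ∀ x : ℝ, charFun ν x = f (x + c * I)) (u : ℝ) :
    ∫ x : ℝ, Complex.exp (-(1 / 2) * ((x : ℂ) + c * I) ^ 2) * f ((x : ℂ) + c * I + u) =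
      (2 * Real.pi : ℂ) ^ (1 / 2 : ℂ) *
        ∫ s : ℝ, Complex.exp (u * s * I) * (Real.exp (c * s - s ^ 2 / 2) : ℝ) ∂ν := by
  have hg : Integrable (fun x : ℝ => Complex.exp (-(1 / 2) * ((x : ℂ) + c * I) ^ 2)) :=
    GaussianFourier.integrable_cexp_neg_mul_sq_add_real_mul_I (b := 1 / 2) (by norm_num) c
  have hf : ∀ x : ℝ, f ((x : ℂ) + c * I + u) = ∫ s : ℝ, Complex.exp ((x + u) * s * I) ∂ν := by
    intro x
    have := hν (x + u)
    rw [charFun_apply_real] at this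
    push_cast at this
    rw [this]; congr 1; ring
  simp_rw [hf, ← integral_const_mul]
  rw [integral_integral_swap]
  · congr 1
    ext s
    have h := integral_cexp_quadratic (b := -(1 / 2)) (by norm_num) (-(c * I) + s * I)
      (c ^ 2 / 2 + u * s * I)
    have e : ∀ x : ℝ, Complex.exp (-(1 / 2) * ((x : ℂ) + c * I) ^ 2) * Complex.exp ((x + u) * s * I) =
        Complex.exp (-(1 / 2) * (x : ℂ) ^ 2 + (-(c * I) + s * I) * x + (c ^ 2 / 2 + u * s * I)) := by
      intro x
      rw [← Complex.exp_add]
      congr 1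
      ring_nf
      rw [Complex.I_sq]; ring
    simp_rw [e]
    rw [h]
    congr 1
    · congr 1; ring
    · rw [Complex.ofReal_exp, ← Complex.exp_add]
      congr 1
      push_cast
      ring_nf
      rw [Complex.I_sq]; ring
  · have h1 : Integrable (fun p : ℝ × ℝ => Complex.exp (-(1 / 2) * ((p.1 : ℂ) + c * I) ^ 2) * 1)
        (volume.prod ν) := hg.mul_prod (integrable_const (1 : ℂ))
    refine h1.mono (by
      apply Continuous.aestronglyMeasurable
      unfold Function.uncurry
      fun_prop) (ae_of_all _ fun p => ?_)
    simp only [Function.uncurry, norm_mul, norm_one]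
    rw [show ((p.1 : ℂ) + u) * p.2 * I = (((p.1 + u) * p.2 : ℝ) : ℂ) * I by push_cast; ring,
      Complex.norm_exp_ofReal_mul_I]

/-! ### Exponential tilting of measures -/

/-- The measure with density `exp ∘ h` with respect to `μ`. -/
def expTilt (μ : Measure ℝ) (h : ℝ → ℝ) : Measure ℝ :=
  μ.withDensity (fun s => ENNReal.ofReal (Real.exp (h s)))

lemma expTilt_expTilt (μ : Measure ℝ) {h k : ℝ → ℝ} (hh : Continuous h) (hk : Continuous k) :
    expTilt (expTilt μ h) k = expTilt μ (fun s => h s + k s) := by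
  unfold expTilt
  rw [← withDensity_mul _ (by fun_prop) (by fun_prop)]
  congr 1
  ext s
  rw [Pi.mul_apply, Real.exp_add, ENNReal.ofReal_mul (Real.exp_pos _).le]

lemma expTilt_zero (μ : Measure ℝ) : expTilt μ (fun _ => 0) = μ := by
  have h : (fun _ : ℝ => ENNReal.ofReal (Real.exp 0)) = 1 := by ext s; simp
  rw [expTilt, h, withDensity_one]

lemma integral_expTilt (μ : Measure ℝ) {h : ℝ → ℝ} (hh : Continuous h) (F : ℝ → ℂ) :
    ∫ s, F s ∂(expTilt μ h) = ∫ s, ((Real.exp (h s) : ℝ) : ℂ) * F s ∂μ := by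
  unfold expTilt
  rw [integral_withDensity_eq_integral_toReal_smul (by fun_prop)
    (ae_of_all _ fun w => ENNReal.ofReal_lt_top)]
  congr 1
  ext s
  rw [ENNReal.toReal_ofReal (Real.exp_pos _).le, Complex.real_smul]

lemma isFinite_expTilt {μ : Measure ℝ} {h : ℝ → ℝ}
    (hi : Integrable (fun s => Real.exp (h s)) μ) : IsFiniteMeasure (expTilt μ h) :=
  isFiniteMeasure_withDensity_ofReal hi.2

lemma integrable_exp_of_finite {μ : Measure ℝ} {h : ℝ → ℝ} (hh : Continuous h)
    (hi : IsFiniteMeasure (expTilt μ h)) : Integrable (fun s => Real.exp (h s)) μ := by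
  refine ⟨by apply Continuous.aestronglyMeasurable; fun_prop, ?_⟩
  rw [hasFiniteIntegral_iff_ofReal (ae_of_all _ fun s => (Real.exp_pos _).le)]
  have := measure_lt_top (expTilt μ h) univ
  rwa [expTilt, withDensity_apply _ MeasurableSet.univ, Measure.restrict_univ] at this

lemma charFun_tilt {μ : Measure ℝ} (c x : ℝ) :
    charFun (expTilt μ (fun s => -c * s)) x =
      ∫ t : ℝ, Complex.exp (I * ((x : ℂ) + c * I) * t) ∂μ := by
  rw [charFun_apply_real, integral_expTilt _ (by fun_prop)]
  congr 1
  ext t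
  rw [Complex.ofReal_exp, ← Complex.exp_add]
  congr 1
  push_cast
  ring_nf
  rw [Complex.I_sq]; ring

lemma tilt_back (μ : Measure ℝ) (c : ℝ) :
    expTilt (expTilt μ (fun s => -c * s)) (fun s => c * s) = μ := by
  rw [expTilt_expTilt _ (by fun_prop) (by fun_prop)]
  conv_rhs => rw [← expTilt_zero μ]
  congr 1
  ext s; ring

lemma exists_mid {a b : EReal} (hab : a < b) : ∃ c : ℝ, a < c ∧ c < b := by
  obtain ⟨q, h1, h2⟩ := EReal.lt_iff_exists_rat_btwn.1 hab
  exact ⟨(q : ℝ), h1, h2⟩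

lemma uniq {a b : EReal} (hab : a < b) {f : ℂ → ℂ} (μ ν : Measure ℝ)
    (h1 : ExpFinite μ a b) (h2 : ∀ z ∈ HStrip a b, f z = ∫ t : ℝ, Complex.exp (I * z * t) ∂μ)
    (h3 : ExpFinite ν a b) (h4 : ∀ z ∈ HStrip a b, f z = ∫ t : ℝ, Complex.exp (I * z * t) ∂ν) :
    μ = ν := by
  obtain ⟨c, hac, hcb⟩ := exists_mid hab
  have i1 := isFinite_expTilt (h1 c hac hcb)
  have i2 := isFinite_expTilt (h3 c hac hcb)
  have : expTilt μ (fun s => -c * s) = expTilt ν (fun s => -c * s) := by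
    apply Measure.ext_of_charFun
    ext x
    have hz : ((x : ℂ) + c * I) ∈ HStrip a b := by simp [HStrip, hac, hcb]
    rw [charFun_tilt, charFun_tilt, ← h2 _ hz, ← h4 _ hz]
  rw [← tilt_back μ c, this, tilt_back]

lemma forward {a b : EReal} (hab : a < b) {f : ℂ → ℂ} (hd : DifferentiableOn ℂ f (HStrip a b))
    (hpd : IsPosDefOnC f (HStrip a b)) :
    ∃ μ : Measure ℝ, ExpFinite μ a b ∧
        ∀ z ∈ HStrip a b, f z = ∫ t : ℝ, Complex.exp (I * z * t) ∂μ := by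
  have H : ∀ c : ℝ, ∃ ν : Measure ℝ, a < c → c < b →
      (IsFiniteMeasure ν ∧ ∀ x : ℝ, charFun ν x = f (x + c * I)) := by
    intro c
    by_cases h : a < c ∧ c < b
    · obtain ⟨ν, h1, h2⟩ := bochner (posDef_line hpd h.1 h.2) (continuous_line hd h.1 h.2)
      exact ⟨ν, fun _ _ => ⟨h1, h2⟩⟩
    · exact ⟨0, fun h1 h2 => (h ⟨h1, h2⟩).elim⟩
  choose ν hν using H
  obtain ⟨c₀, hac₀, hcb₀⟩ := exists_mid hab
  have hfin : ∀ c : ℝ, a < c → c < b →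
      IsFiniteMeasure (expTilt (ν c) (fun s => c * s - s ^ 2 / 2)) := by
    intro c h1 h2
    obtain ⟨hf, -⟩ := hν c h1 h2
    apply isFinite_expTilt
    refine Integrable.of_bound (C := Real.exp (c ^ 2 / 2)) (by
      apply Continuous.aestronglyMeasurable; fun_prop) (ae_of_all _ fun s => ?_)
    rw [Real.norm_eq_abs, abs_of_pos (Real.exp_pos _), Real.exp_le_exp]
    nlinarith [sq_nonneg (c - s)]
  have hsm : ∀ c : ℝ, a < c → c < b → expTilt (ν c) (fun s => c * s - s ^ 2 / 2) =
      expTilt (ν c₀) (fun s => c₀ * s - s ^ 2 / 2) := by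
    intro c h1 h2
    have i1 := hfin c h1 h2
    have i2 := hfin c₀ hac₀ hcb₀
    apply Measure.ext_of_charFun
    ext u
    obtain ⟨j1, k1⟩ := hν c h1 h2
    obtain ⟨j2, k2⟩ := hν c₀ hac₀ hcb₀
    have h := shift_strip hd hpd h1 h2 hac₀ hcb₀ u
    rw [smooth_line k1, smooth_line k2] at h
    have hne : (2 * Real.pi : ℂ) ^ (1 / 2 : ℂ) ≠ 0 := by
      have : (2 * Real.pi : ℂ) ≠ 0 := by
        simp [Real.pi_ne_zero]
      simp [Complex.cpow_eq_zero_iff, this]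
    have h' := mul_left_cancel₀ hne h
    rw [charFun_apply_real, charFun_apply_real, integral_expTilt _ (by fun_prop),
      integral_expTilt _ (by fun_prop)]
    simp_rw [mul_comm ((Real.exp _ : ℝ) : ℂ)]
    exact h'
  have htilt : ∀ c : ℝ, a < c → c < b → expTilt (ν c) (fun s => c * s) =
      expTilt (ν c₀) (fun s => c₀ * s) := by
    intro c h1 h2
    have e : ∀ c : ℝ, expTilt (expTilt (ν c) (fun s => c * s - s ^ 2 / 2)) (fun s => s ^ 2 / 2) =
        expTilt (ν c) (fun s => c * s) := by
      intro c
      rw [expTilt_expTilt _ (by fun_prop) (by fun_prop)]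
      congr 1
      ext s; ring
    rw [← e c, hsm c h1 h2, e c₀]
  have hback : ∀ c : ℝ, a < c → c < b →
      expTilt (expTilt (ν c₀) (fun s => c₀ * s)) (fun s => -c * s) = ν c := by
    intro c h1 h2
    rw [← htilt c h1 h2, expTilt_expTilt _ (by fun_prop) (by fun_prop)]
    conv_rhs => rw [← expTilt_zero (ν c)]
    congr 1
    ext s; ring
  refine ⟨expTilt (ν c₀) (fun s => c₀ * s), ?_, ?_⟩
  · intro y h1 h2
    apply integrable_exp_of_finite (by fun_prop)
    rw [hback y h1 h2]
    exact (hν y h1 h2).1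
  · intro z hz
    have h := charFun_tilt (μ := expTilt (ν c₀) (fun s => c₀ * s)) z.im z.re
    rw [hback z.im hz.1 hz.2, (hν z.im hz.1 hz.2).2, Complex.re_add_im] at h
    exact h

lemma integrable_FL {a b : EReal} {μ : Measure ℝ} (hμ : ExpFinite μ a b) {z : ℂ}
    (hz : z ∈ HStrip a b) : Integrable (fun t : ℝ => Complex.exp (I * z * t)) μ := by
  refine (hμ z.im hz.1 hz.2).mono' (by apply Continuous.aestronglyMeasurable; fun_prop)
    (ae_of_all _ fun t => ?_)
  rw [Complex.norm_exp]
  simp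

lemma backward {a b : EReal} {f : ℂ → ℂ} {μ : Measure ℝ} (hμ : ExpFinite μ a b)
    (hf : ∀ z ∈ HStrip a b, f z = ∫ t : ℝ, Complex.exp (I * z * t) ∂μ) :
    DifferentiableOn ℂ f (HStrip a b) ∧ IsPosDefOnC f (HStrip a b) := by
  constructor
  · have hd := ProbabilityTheory.differentiableOn_complexMGF (X := id) (μ := μ)
    have hc : DifferentiableOn ℂ (fun z : ℂ => ProbabilityTheory.complexMGF id μ (I * z))
        (HStrip a b) := by
      refine hd.comp (by fun_prop) (fun z hz => ?_)
      have hopen : IsOpen {y : ℝ | a < ((-y : ℝ) : EReal) ∧ ((-y : ℝ) : EReal) < b} := by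
        have h : Continuous (fun y : ℝ => ((-y : ℝ) : EReal)) :=
          continuous_coe_real_ereal.comp continuous_neg
        exact (isOpen_lt continuous_const h).inter (isOpen_lt h continuous_const)
      refine interior_maximal (t := {y : ℝ | a < ((-y : ℝ) : EReal) ∧ ((-y : ℝ) : EReal) < b})
        ?_ hopen ?_
      · intro y hy
        have := hμ (-y) hy.1 hy.2
        simpa [ProbabilityTheory.integrableExpSet] using this
      · simpa [HStrip] using hz
    refine hc.congr fun z hz => ?_
    rw [hf z hz]
    rfl
  · intro n z hz ξ
    have hterm : ∀ k l, f (z k - (starRingEnd ℂ) (z l)) * ξ k * (starRingEnd ℂ) (ξ l) =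
        ∫ t : ℝ, Complex.exp (I * (z k - (starRingEnd ℂ) (z l)) * t) *
          (ξ k * (starRingEnd ℂ) (ξ l)) ∂μ := by
      intro k l
      rw [hf _ (hz k l), integral_mul_const, mul_assoc]
    have hInt : ∀ k l, Integrable (fun t : ℝ => Complex.exp (I * (z k - (starRingEnd ℂ) (z l)) * t) *
          (ξ k * (starRingEnd ℂ) (ξ l))) μ := fun k l =>
      (integrable_FL hμ (hz k l)).mul_const _
    simp_rw [hterm]
    simp_rw [← integral_finsetSum _ (fun l _ => hInt _ l)]
    rw [← integral_finsetSum _ (fun k _ => integrable_finsetSum _ fun l _ => hInt k l)]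
    refine integral_nonneg fun t => ?_
    have : (∑ k, ∑ l, Complex.exp (I * (z k - (starRingEnd ℂ) (z l)) * t) *
        (ξ k * (starRingEnd ℂ) (ξ l))) =
        (∑ k, Complex.exp (I * z k * t) * ξ k) *
          (starRingEnd ℂ) (∑ k, Complex.exp (I * z k * t) * ξ k) := by
      rw [map_sum, Finset.sum_mul_sum]
      refine Finset.sum_congr rfl fun k _ => Finset.sum_congr rfl fun l _ => ?_
      rw [map_mul, ← Complex.exp_conj, map_mul, map_mul, Complex.conj_I, Complex.conj_ofReal]
      have : Complex.exp (I * (z k - (starRingEnd ℂ) (z l)) * t) =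
          Complex.exp (I * z k * t) * Complex.exp (-I * (starRingEnd ℂ) (z l) * t) := by
        rw [← Complex.exp_add]; congr 1; ring
      rw [this]; ring
    simp only [Pi.zero_apply]
    rw [this, Complex.mul_conj, Complex.zero_le_real]
    exact Complex.normSq_nonneg _

/-- A function on the horizontal strip `S_{a,b}` is holomorphic and positive definite iff it is
the Fourier–Laplace transform of a measure exponentially finite with respect to `(a,b)`;
the representing measure is uniquely determined by `f`. -/
theorem stmt8 (a b : EReal) (hab : a < b) (f : ℂ → ℂ) :
    ((DifferentiableOn ℂ f (HStrip a b) ∧ IsPosDefOnC f (HStrip a b)) ↔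
      ∃ μ : Measure ℝ, ExpFinite μ a b ∧
        ∀ z ∈ HStrip a b, f z = ∫ t : ℝ, Complex.exp (I * z * t) ∂μ) ∧
    (∀ μ ν : Measure ℝ,
      ExpFinite μ a b → (∀ z ∈ HStrip a b, f z = ∫ t : ℝ, Complex.exp (I * z * t) ∂μ) →
      ExpFinite ν a b → (∀ z ∈ HStrip a b, f z = ∫ t : ℝ, Complex.exp (I * z * t) ∂ν) →
      μ = ν) := by
  refine ⟨⟨fun h => forward hab h.1 h.2, ?_⟩, fun μ ν h1 h2 h3 h4 => uniq hab μ ν h1 h2 h3 h4⟩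
  rintro ⟨μ, hμ, hf⟩
  exact backward hμ hf
end
end
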